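/- arXiv:1008.3944 — 7 statements merged into one kernel-verified Lean document; each statement's English description precedes it below -/
import Mathlib

section
/- For every dimension d ≥ 3 there exist convex bodies K ⊆ L ⊆ ℝ^d such that det A(K) > det A(L), where A(·) denotes the covariance matrix of a uniformly random point in the body. -/
open MeasureTheory

/-- A convex body in `ℝ^d`: a compact convex set with nonempty interior. -/
def IsConvexBody {d : ℕ} (K : Set (EuclideanSpace ℝ (Fin d))) : Prop :=
  IsCompact K ∧ Convex ℝ K ∧ (interior K).Nonempty

/-- The centroid `μ(K)` of `K`: the expectation of a uniformly random point of `K`. -/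
noncomputable def centroid {d : ℕ} (K : Set (EuclideanSpace ℝ (Fin d))) :
    EuclideanSpace ℝ (Fin d) :=
  ⨍ x in K, x

/-- The covariance matrix `A(K)` of a uniformly random point of `K`. -/
noncomputable def covMatrix {d : ℕ} (K : Set (EuclideanSpace ℝ (Fin d))) :
    Matrix (Fin d) (Fin d) ℝ :=
  Matrix.of fun i j => ⨍ x in K, (x i - centroid K i) * (x j - centroid K j)



/-- The points `x` of `ℝ^(m+1)` with first coordinate in `[a, b]` whose other coordinates
satisfy `|x (j + 1)| ≤ ρ j (x 0)`. -/
def boxTube {m : ℕ} (a b : ℝ) (ρ : Fin m → ℝ → ℝ) : Set (EuclideanSpace ℝ (Fin (m + 1))) :=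
  {x | x 0 ∈ Set.Icc a b ∧ ∀ j, |x j.succ| ≤ ρ j (x 0)}

lemma isCompact_boxTube {m : ℕ} {a b : ℝ} {ρ : Fin m → ℝ → ℝ} (hρ : ∀ j, Continuous (ρ j))
    {C : ℝ} (hC : ∀ j, ∀ s ∈ Set.Icc a b, ρ j s ≤ C) : IsCompact (boxTube a b ρ) := by
  have hclosed : IsClosed (boxTube a b ρ) := by
    have h : boxTube a b ρ = {x | a ≤ x 0} ∩ {x | x 0 ≤ b} ∩
        ⋂ j, {x | |x (Fin.succ j)| ≤ ρ j (x 0)} := by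
      ext x; simp [boxTube]
    rw [h]
    refine ((isClosed_le (by fun_prop) (by fun_prop)).inter
      (isClosed_le (by fun_prop) (by fun_prop))).inter (isClosed_iInter fun j => ?_)
    have := hρ j
    exact isClosed_le (by fun_prop) (by fun_prop)
  have hbox : IsCompact (WithLp.toLp 2 ''
      (Set.pi Set.univ fun i : Fin (m + 1) => Set.Icc (min a (-C)) (max b C))) :=
    (isCompact_univ_pi fun _ => isCompact_Icc).image (PiLp.continuous_toLp 2 _)
  refine hbox.of_isClosed_subset hclosed fun x hx => ⟨x.ofLp, ?_, rfl⟩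
  rintro i -
  refine Fin.cases ?_ (fun j => ?_) i
  · exact ⟨min_le_of_left_le hx.1.1, le_max_of_le_left hx.1.2⟩
  · have h := abs_le.1 ((hx.2 j).trans (hC j _ hx.1))
    exact ⟨min_le_of_right_le h.1, le_max_of_le_right h.2⟩

lemma convex_boxTube {m : ℕ} {a b : ℝ} {ρ : Fin m → ℝ → ℝ}
    (hρ : ∀ j, ConcaveOn ℝ Set.univ (ρ j)) : Convex ℝ (boxTube a b ρ) := by
  intro x hx y hy s t hs ht hst
  refine ⟨convex_Icc a b hx.1 hy.1 hs ht hst, fun j => ?_⟩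
  have h := (hρ j).2 (Set.mem_univ (x 0)) (Set.mem_univ (y 0)) hs ht hst
  have h1 := mul_le_mul_of_nonneg_left (hx.2 j) hs
  have h2 := mul_le_mul_of_nonneg_left (hy.2 j) ht
  simp only [PiLp.add_apply, PiLp.smul_apply, smul_eq_mul] at h ⊢
  calc |s * x j.succ + t * y j.succ| ≤ |s * x j.succ| + |t * y j.succ| := abs_add_le _ _
    _ = s * |x j.succ| + t * |y j.succ| := by
      rw [abs_mul, abs_mul, abs_of_nonneg hs, abs_of_nonneg ht]
    _ ≤ _ := by linarith

lemma interior_boxTube_nonempty {m : ℕ} {a b : ℝ} {ρ : Fin m → ℝ → ℝ}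
    (hρ : ∀ j, Continuous (ρ j)) (ha : a < 0) (hb : 0 < b) (h0 : ∀ j, 0 < ρ j 0) :
    (interior (boxTube a b ρ)).Nonempty := by
  have hopen : IsOpen ({x | a < x 0} ∩ {x | x 0 < b} ∩
      ⋂ j, {x : EuclideanSpace ℝ (Fin (m + 1)) | |x (Fin.succ j)| < ρ j (x 0)}) := by
    refine ((isOpen_lt (by fun_prop) (by fun_prop)).inter
      (isOpen_lt (by fun_prop) (by fun_prop))).inter (isOpen_iInter_of_finite fun j => ?_)
    have := hρ j
    exact isOpen_lt (by fun_prop) (by fun_prop)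
  refine ⟨0, mem_interior.2 ⟨_, ?_, hopen, ?_⟩⟩
  · rintro x ⟨⟨h1, h2⟩, h3⟩
    exact ⟨⟨le_of_lt h1, le_of_lt h2⟩, fun j => le_of_lt (Set.mem_iInter.1 h3 j)⟩
  · simpa using ⟨⟨ha, hb⟩, h0⟩

/-- Moments of a tube as one-dimensional integrals. -/
lemma setIntegral_boxTube {m : ℕ} {a b : ℝ} {ρ : Fin m → ℝ → ℝ} (hab : a ≤ b)
    (hcpt : IsCompact (boxTube a b ρ)) (hpos : ∀ j, ∀ s ∈ Set.Icc a b, 0 ≤ ρ j s)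
    {f : ℝ → ℝ} (hf : Continuous f) (k : Fin m → ℕ) :
    ∫ x in boxTube a b ρ, f (x 0) * ∏ j, x j.succ ^ k j =
      ∫ s in a..b, f s * ∏ j, ∫ t in -ρ j s..ρ j s, t ^ k j := by
  have hint : IntegrableOn (fun x => f (x 0) * ∏ j, x (Fin.succ j) ^ k j) (boxTube a b ρ) :=
    Continuous.continuousOn (by fun_prop) |>.integrableOn_compact hcpt
  rw [← integral_indicator hcpt.measurableSet]
  rw [← integrable_indicator_iff hcpt.measurableSet] at hint
  have hmp := (volume_preserving_piFinSuccAbove (fun _ : Fin (m + 1) => ℝ) 0).comp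
    (EuclideanSpace.volume_preserving_symm_measurableEquiv_toLp (Fin (m + 1)))
  have hemb : MeasurableEmbedding ((MeasurableEquiv.piFinSuccAbove (fun _ : Fin (m + 1) => ℝ) 0) ∘
      (MeasurableEquiv.toLp 2 (Fin (m + 1) → ℝ)).symm) :=
    (MeasurableEquiv.measurableEmbedding _).comp (MeasurableEquiv.measurableEmbedding _)
  set G : ℝ × (Fin m → ℝ) → ℝ := fun p => (Set.Icc a b).indicator f p.1 *
    ∏ j, (Set.Icc (-ρ j p.1) (ρ j p.1)).indicator (fun t => t ^ k j) (p.2 j) with hG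
  have hF : (boxTube a b ρ).indicator (fun x => f (x 0) * ∏ j, x (Fin.succ j) ^ k j) =
      G ∘ ((MeasurableEquiv.piFinSuccAbove (fun _ : Fin (m + 1) => ℝ) 0) ∘
      (MeasurableEquiv.toLp 2 (Fin (m + 1) → ℝ)).symm) := by
    funext x
    have hval : ((MeasurableEquiv.piFinSuccAbove (fun _ : Fin (m + 1) => ℝ) 0)
      ((MeasurableEquiv.toLp 2 (Fin (m + 1) → ℝ)).symm x)) = (x 0, fun j => x (Fin.succ j)) := rfl
    simp only [Function.comp, hval, hG]
    by_cases hx0 : x 0 ∈ Set.Icc a b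
    · rw [Set.indicator_of_mem hx0]
      by_cases hx : ∀ j, |x j.succ| ≤ ρ j (x 0)
      · rw [Set.indicator_of_mem (show x ∈ boxTube a b ρ from ⟨hx0, hx⟩)]
        congr 1
        refine Finset.prod_congr rfl fun j _ => ?_
        rw [Set.indicator_of_mem (Set.mem_Icc.2 (abs_le.1 (hx j)))]
      · rw [Set.indicator_of_notMem (fun h : x ∈ boxTube a b ρ => hx h.2)]
        push Not at hx
        obtain ⟨j, hj⟩ := hx
        rw [Finset.prod_eq_zero (Finset.mem_univ j), mul_zero]
        exact Set.indicator_of_notMem (fun h => absurd (abs_le.2 (Set.mem_Icc.1 h)) (not_le.2 hj)) _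
    · rw [Set.indicator_of_notMem hx0, Set.indicator_of_notMem
        (fun h : x ∈ boxTube a b ρ => hx0 h.1), zero_mul]
  rw [hF] at hint ⊢
  rw [hmp.integrable_comp_emb hemb] at hint
  refine (hmp.integral_comp hemb G).trans ?_
  rw [Measure.volume_eq_prod] at hint ⊢
  rw [integral_prod _ hint, intervalIntegral.integral_of_le hab, ← integral_Icc_eq_integral_Ioc,
    ← integral_indicator measurableSet_Icc]
  congr 1
  funext s
  simp only [hG, integral_const_mul]
  by_cases hs : s ∈ Set.Icc a b
  · rw [Set.indicator_of_mem hs, Set.indicator_of_mem hs]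
    congr 1
    rw [integral_fintype_prod_volume_eq_prod
      (fun j t => (Set.Icc (-ρ j s) (ρ j s)).indicator (fun t => t ^ k j) t)]
    refine Finset.prod_congr rfl fun j _ => ?_
    rw [integral_indicator measurableSet_Icc, integral_Icc_eq_integral_Ioc,
      intervalIntegral.integral_of_le (by linarith [hpos j s hs])]
  · rw [Set.indicator_of_notMem hs, Set.indicator_of_notMem hs, zero_mul]

lemma Finset.prod_pow_single {ι : Type*} [Fintype ι] [DecidableEq ι] (y : ι → ℝ) (j : ι) (n : ℕ) :
    ∏ i, y i ^ (Pi.single j n : ι → ℕ) i = y j ^ n := by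
  rw [Finset.prod_eq_single j (fun i _ h => by simp [Pi.single_eq_of_ne h]) (by simp),
    Pi.single_eq_same]

lemma setIntegral_boxTube_base {m : ℕ} {a b : ℝ} {ρ : Fin m → ℝ → ℝ} (hab : a ≤ b)
    (hcpt : IsCompact (boxTube a b ρ)) (hpos : ∀ j, ∀ s ∈ Set.Icc a b, 0 ≤ ρ j s)
    {f : ℝ → ℝ} (hf : Continuous f) :
    ∫ x in boxTube a b ρ, f (x 0) = ∫ s in a..b, f s * ∏ j, (2 * ρ j s) := by
  have h := setIntegral_boxTube hab hcpt hpos hf 0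
  simpa [← two_mul] using h

lemma setIntegral_boxTube_eq_zero {m : ℕ} {a b : ℝ} {ρ : Fin m → ℝ → ℝ} (hab : a ≤ b)
    (hcpt : IsCompact (boxTube a b ρ)) (hpos : ∀ j, ∀ s ∈ Set.Icc a b, 0 ≤ ρ j s)
    {f : ℝ → ℝ} (hf : Continuous f) (k : Fin m → ℕ) (j : Fin m) (hj : k j = 1) :
    ∫ x in boxTube a b ρ, f (x 0) * ∏ j, x j.succ ^ k j = 0 := by
  rw [setIntegral_boxTube hab hcpt hpos hf k]
  have h : ∀ s, ∏ j, ∫ t in -ρ j s..ρ j s, t ^ k j = 0 := fun s =>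
    Finset.prod_eq_zero (Finset.mem_univ j) (by simp [hj])
  simp only [h, mul_zero, intervalIntegral.integral_zero]

lemma setIntegral_boxTube_sq {m : ℕ} {a b : ℝ} {ρ : Fin m → ℝ → ℝ} (hab : a ≤ b)
    (hcpt : IsCompact (boxTube a b ρ)) (hpos : ∀ j, ∀ s ∈ Set.Icc a b, 0 ≤ ρ j s) (j : Fin m) :
    ∫ x in boxTube a b ρ, x j.succ ^ 2 =
      ∫ s in a..b, ρ j s ^ 2 / 3 * ∏ i, (2 * ρ i s) := by
  have h := setIntegral_boxTube hab hcpt hpos (f := fun _ => 1) continuous_const (Pi.single j 2)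
  simp only [Finset.prod_pow_single, one_mul] at h
  rw [h]
  congr 1
  funext s
  have hi : ∀ i, ∫ t in -ρ i s..ρ i s, t ^ (Pi.single j 2 : Fin m → ℕ) i =
      (if i = j then ρ j s ^ 2 / 3 else 1) * (2 * ρ i s) := by
    intro i
    split_ifs with hij
    · subst hij
      rw [Pi.single_eq_same, integral_pow]
      push_cast
      ring
    · rw [Pi.single_eq_of_ne hij, integral_pow]
      push_cast
      ring
  simp_rw [hi]
  rw [Finset.prod_mul_distrib]
  simp

lemma centroid_apply {d : ℕ} {K : Set (EuclideanSpace ℝ (Fin d))} (hK : IsCompact K) (i : Fin d) :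
    centroid K i = ⨍ x in K, x i := by
  have hint : IntegrableOn (fun x : EuclideanSpace ℝ (Fin d) => x) K :=
    continuous_id.continuousOn.integrableOn_compact hK
  have h := (EuclideanSpace.proj (𝕜 := ℝ) i).integral_comp_comm hint
  simp only [EuclideanSpace.coe_proj] at h
  rw [centroid, setAverage_eq, setAverage_eq, PiLp.smul_apply, h]

/-- The covariance matrix of a tube is diagonal. -/
lemma covMatrix_boxTube {m : ℕ} {a b : ℝ} {ρ : Fin m → ℝ → ℝ} (hab : a ≤ b)
    (hcpt : IsCompact (boxTube a b ρ)) (hpos : ∀ j, ∀ s ∈ Set.Icc a b, 0 ≤ ρ j s)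
    {V S : ℝ} (hV : ∫ s in a..b, ∏ j, (2 * ρ j s) = V)
    (hS : ∫ s in a..b, s * ∏ j, (2 * ρ j s) = S) :
    covMatrix (boxTube a b ρ) = Matrix.diagonal (Fin.cons
      (V⁻¹ * ∫ s in a..b, (s - V⁻¹ * S) ^ 2 * ∏ j, (2 * ρ j s))
      (fun j => V⁻¹ * ∫ s in a..b, ρ j s ^ 2 / 3 * ∏ i, (2 * ρ i s))) := by
  have hvol : volume.real (boxTube a b ρ) = V := by
    have h := setIntegral_boxTube_base hab hcpt hpos (f := fun _ => 1) continuous_const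
    simpa [hV] using h
  have hc0 : centroid (boxTube a b ρ) 0 = V⁻¹ * S := by
    rw [centroid_apply hcpt, setAverage_eq, hvol, smul_eq_mul,
      setIntegral_boxTube_base hab hcpt hpos (f := fun s => s) continuous_id, hS]
  have hcs : ∀ j : Fin m, centroid (boxTube a b ρ) j.succ = 0 := by
    intro j
    have h := setIntegral_boxTube_eq_zero hab hcpt hpos (f := fun _ => 1) continuous_const
      (Pi.single j 1) j (by simp)
    simp only [Finset.prod_pow_single, one_mul, pow_one] at h
    rw [centroid_apply hcpt, setAverage_eq, h, smul_zero]
  have h0s : ∀ j : Fin m, ∫ x in boxTube a b ρ, (x 0 - V⁻¹ * S) * x j.succ = 0 := by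
    intro j
    have h := setIntegral_boxTube_eq_zero hab hcpt hpos (f := fun s => s - V⁻¹ * S)
      (by fun_prop) (Pi.single j 1) j (by simp)
    simpa only [Finset.prod_pow_single, pow_one] using h
  have hss : ∀ i j : Fin m, i ≠ j → ∫ x in boxTube a b ρ, x i.succ * x j.succ = 0 := by
    intro i j hij
    have h := setIntegral_boxTube_eq_zero hab hcpt hpos (f := fun _ => 1) continuous_const
      (Pi.single i 1 + Pi.single j 1) j (by simp [Pi.single_eq_of_ne hij.symm])
    simpa only [Pi.add_apply, pow_add, Finset.prod_mul_distrib, Finset.prod_pow_single, one_mul,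
      pow_one] using h
  ext i j
  simp only [covMatrix, Matrix.of_apply, setAverage_eq, hvol, smul_eq_mul]
  refine Fin.cases ?_ (fun i => ?_) i <;> refine Fin.cases ?_ (fun j => ?_) j
  · rw [Matrix.diagonal_apply_eq, Fin.cons_zero, hc0,
      ← setIntegral_boxTube_base hab hcpt hpos (f := fun s => (s - V⁻¹ * S) ^ 2) (by fun_prop)]
    simp only [pow_two]
  · rw [Matrix.diagonal_apply_ne _ (Fin.succ_ne_zero j).symm, hc0, hcs]
    simp only [sub_zero, h0s, mul_zero]
  · rw [Matrix.diagonal_apply_ne _ (Fin.succ_ne_zero i), hc0, hcs]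
    simp only [sub_zero]
    simp_rw [mul_comm _ (_ - _)]
    rw [h0s, mul_zero]
  · rw [hcs, hcs]
    simp only [sub_zero]
    by_cases hij : i = j
    · subst hij
      rw [Matrix.diagonal_apply_eq, Fin.cons_succ, ← setIntegral_boxTube_sq hab hcpt hpos]
      simp only [pow_two]
    · rw [Matrix.diagonal_apply_ne _ (fun h => hij (Fin.succ_injective _ h)), hss i j hij,
        mul_zero]

/-- The profile of a double cone over the base at height `0`, with apexes at heights `1`
and `-1/10`. -/
noncomputable def bipyramidWidth (s : ℝ) : ℝ := min (1 - s) (1 + 10 * s)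

lemma continuous_bipyramidWidth : Continuous bipyramidWidth := by
  unfold bipyramidWidth
  fun_prop

lemma concaveOn_bipyramidWidth : ConcaveOn ℝ Set.univ bipyramidWidth := by
  refine ConcaveOn.inf ⟨convex_univ, ?_⟩ ⟨convex_univ, ?_⟩ <;>
  · intro x _ y _ s t _ _ hst
    obtain rfl : t = 1 - s := by linarith
    simp only [smul_eq_mul]
    apply le_of_eq
    ring

lemma bipyramidWidth_nonneg {s : ℝ} (h : s ∈ Set.Icc (-1 / 10 : ℝ) 1) : 0 ≤ bipyramidWidth s :=
  le_min (by linarith [h.2]) (by linarith [h.1])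

lemma bipyramidWidth_le {s : ℝ} : bipyramidWidth s ≤ 1 := by
  rcases le_total s 0 with h | h
  · exact (min_le_right _ _).trans (by linarith)
  · exact (min_le_left _ _).trans (by linarith)

/-- Two widths equal to `bipyramidWidth`, followed by `n` constant widths `1`. -/
noncomputable def bipyramidWidths (n : ℕ) : Fin (n + 2) → ℝ → ℝ :=
  Fin.cons bipyramidWidth (Fin.cons bipyramidWidth fun _ _ => 1)

lemma bipyramidWidths_cases {n : ℕ} {p : (ℝ → ℝ) → Prop} (h : p bipyramidWidth)
    (h1 : p fun _ => 1) (j : Fin (n + 2)) : p (bipyramidWidths n j) := by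
  refine Fin.cases h (fun j => Fin.cases h (fun _ => h1) j) j

lemma prod_bipyramidWidths (n : ℕ) (s : ℝ) :
    ∏ j, (2 * bipyramidWidths n j s) = 2 ^ (n + 2) * bipyramidWidth s ^ 2 := by
  rw [Fin.prod_univ_succ, Fin.prod_univ_succ]
  simp only [bipyramidWidths, Fin.cons_zero, Fin.cons_succ, mul_one, Finset.prod_const,
    Finset.card_univ, Fintype.card_fin]
  ring

lemma isConvexBody_bipyramid (n : ℕ) {a : ℝ} (ha : a < 0) :
    IsConvexBody (boxTube a 1 (bipyramidWidths n)) := by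
  have hc : ∀ j, Continuous (bipyramidWidths n j) :=
    bipyramidWidths_cases continuous_bipyramidWidth continuous_const
  refine ⟨isCompact_boxTube hc (C := 1) fun j s _ => ?_, convex_boxTube ?_,
    interior_boxTube_nonempty hc ha one_pos ?_⟩
  · exact bipyramidWidths_cases (p := fun f => f s ≤ 1) bipyramidWidth_le le_rfl j
  · exact bipyramidWidths_cases concaveOn_bipyramidWidth (concaveOn_const 1 convex_univ)
  · exact bipyramidWidths_cases (p := fun f => 0 < f 0) (by simp [bipyramidWidth]) one_pos

lemma det_covMatrix_bipyramid (n : ℕ) {a V S T Q : ℝ} (ha : a < 0) (ha' : -1 / 10 ≤ a)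
    (hV0 : V ≠ 0) (hV : ∫ s in a..1, bipyramidWidth s ^ 2 = V)
    (hS : ∫ s in a..1, s * bipyramidWidth s ^ 2 = S)
    (hT : ∫ s in a..1, (s - V⁻¹ * S) ^ 2 * bipyramidWidth s ^ 2 = T)
    (hQ : ∫ s in a..1, bipyramidWidth s ^ 2 / 3 * bipyramidWidth s ^ 2 = Q) :
    (covMatrix (boxTube a 1 (bipyramidWidths n))).det =
      V⁻¹ * T * (V⁻¹ * Q) ^ 2 * (1 / 3) ^ n := by
  have hpos : ∀ j, ∀ s ∈ Set.Icc a 1, 0 ≤ bipyramidWidths n j s := fun j s hs =>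
    bipyramidWidths_cases (p := fun f => 0 ≤ f s)
      (bipyramidWidth_nonneg ⟨ha'.trans hs.1, hs.2⟩) zero_le_one j
  have hscale : ∀ g : ℝ → ℝ, ∫ s in a..1, g s * (2 ^ (n + 2) * bipyramidWidth s ^ 2) =
      2 ^ (n + 2) * ∫ s in a..1, g s * bipyramidWidth s ^ 2 := by
    intro g
    rw [← intervalIntegral.integral_const_mul]
    simp only [mul_left_comm]
  have hP : (2 ^ (n + 2) : ℝ) ≠ 0 := by positivity
  have hinv : ∀ x : ℝ, (2 ^ (n + 2) * V)⁻¹ * (2 ^ (n + 2) * x) = V⁻¹ * x := by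
    intro x
    field_simp
  rw [covMatrix_boxTube (by linarith) (isConvexBody_bipyramid n ha).1 hpos
    (V := 2 ^ (n + 2) * V) (S := 2 ^ (n + 2) * S)
    (by simp only [prod_bipyramidWidths, intervalIntegral.integral_const_mul, hV])
    (by simp only [prod_bipyramidWidths, hscale, hS]), Matrix.det_diagonal]
  simp only [prod_bipyramidWidths, hinv, hscale]
  rw [Fin.prod_univ_succ, Fin.prod_univ_succ, Fin.prod_univ_succ]
  simp only [bipyramidWidths, Fin.cons_zero, Fin.cons_succ, hT, hQ, Finset.prod_const,
    Finset.card_univ, Fintype.card_fin, intervalIntegral.integral_const_mul, hV]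
  have h3 : V⁻¹ * (1 ^ 2 / 3 * V) = 1 / 3 := by
    field_simp
  rw [h3]
  ring

lemma integral_quartic (u v c₀ c₁ c₂ c₃ c₄ : ℝ) :
    ∫ s in u..v, (c₀ + c₁ * s + c₂ * s ^ 2 + c₃ * s ^ 3 + c₄ * s ^ 4) =
      (c₀ * v + c₁ * v ^ 2 / 2 + c₂ * v ^ 3 / 3 + c₃ * v ^ 4 / 4 + c₄ * v ^ 5 / 5) -
      (c₀ * u + c₁ * u ^ 2 / 2 + c₂ * u ^ 3 / 3 + c₃ * u ^ 4 / 4 + c₄ * u ^ 5 / 5) := by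
  refine intervalIntegral.integral_eq_sub_of_hasDerivAt (f := fun v => c₀ * v + c₁ * v ^ 2 / 2 +
    c₂ * v ^ 3 / 3 + c₃ * v ^ 4 / 4 + c₄ * v ^ 5 / 5) (fun x _ => ?_)
    (Continuous.intervalIntegrable (by fun_prop) _ _)
  have h1 := (hasDerivAt_id x).const_mul c₀
  have h2 := ((hasDerivAt_pow 2 x).const_mul c₁).div_const 2
  have h3 := ((hasDerivAt_pow 3 x).const_mul c₂).div_const 3
  have h4 := ((hasDerivAt_pow 4 x).const_mul c₃).div_const 4
  have h5 := ((hasDerivAt_pow 5 x).const_mul c₄).div_const 5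
  refine ((((h1.add h2).add h3).add h4).add h5).congr_deriv ?_
  norm_num
  ring

lemma integral_bipyramidWidth {p : ℝ → ℝ → ℝ} (hp : Continuous fun z : ℝ × ℝ => p z.1 z.2)
    {a : ℝ} (ha : a < 0) :
    ∫ s in a..1, p s (bipyramidWidth s) =
      (∫ s in a..0, p s (1 + 10 * s)) + ∫ s in (0 : ℝ)..1, p s (1 - s) := by
  have hc : Continuous fun s => p s (bipyramidWidth s) :=
    hp.comp (continuous_id.prodMk continuous_bipyramidWidth)
  rw [← intervalIntegral.integral_add_adjacent_intervals (b := 0)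
    (hc.intervalIntegrable _ _) (hc.intervalIntegrable _ _)]
  congr 1
  · refine intervalIntegral.integral_congr fun s hs => ?_
    rw [Set.uIcc_of_le ha.le] at hs
    simp only [bipyramidWidth, min_eq_right (show 1 + 10 * s ≤ 1 - s by linarith [hs.2])]
  · refine intervalIntegral.integral_congr fun s hs => ?_
    rw [Set.uIcc_of_le zero_le_one] at hs
    simp only [bipyramidWidth, min_eq_left (show 1 - s ≤ 1 + 10 * s by linarith [hs.1])]

lemma integral_quadratic_mul_bipyramidWidth_sq (q₀ q₁ q₂ : ℝ) {a : ℝ} (ha : a < 0) :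
    ∫ s in a..1, (q₀ + q₁ * s + q₂ * s ^ 2) * bipyramidWidth s ^ 2 =
      q₀ / 3 + q₁ / 12 + q₂ / 30 - (q₀ * a + (20 * q₀ + q₁) * a ^ 2 / 2 +
        (100 * q₀ + 20 * q₁ + q₂) * a ^ 3 / 3 + (100 * q₁ + 20 * q₂) * a ^ 4 / 4 +
        100 * q₂ * a ^ 5 / 5) := by
  rw [integral_bipyramidWidth (p := fun s r => (q₀ + q₁ * s + q₂ * s ^ 2) * r ^ 2)
    (by fun_prop) ha]
  have h1 : ∀ s : ℝ, (q₀ + q₁ * s + q₂ * s ^ 2) * (1 + 10 * s) ^ 2 =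
      q₀ + (20 * q₀ + q₁) * s + (100 * q₀ + 20 * q₁ + q₂) * s ^ 2 +
        (100 * q₁ + 20 * q₂) * s ^ 3 + (100 * q₂) * s ^ 4 := fun s => by ring
  have h2 : ∀ s : ℝ, (q₀ + q₁ * s + q₂ * s ^ 2) * (1 - s) ^ 2 =
      q₀ + (q₁ - 2 * q₀) * s + (q₀ - 2 * q₁ + q₂) * s ^ 2 +
        (q₁ - 2 * q₂) * s ^ 3 + q₂ * s ^ 4 := fun s => by ring
  simp only [h1, h2, integral_quartic]
  ring

lemma integral_bipyramidWidth_pow_four {a : ℝ} (ha : a < 0) :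
    ∫ s in a..1, bipyramidWidth s ^ 2 / 3 * bipyramidWidth s ^ 2 =
      1 / 15 - (a / 3 + 20 * a ^ 2 / 3 + 200 * a ^ 3 / 3 + 1000 * a ^ 4 / 3 +
        2000 * a ^ 5 / 3) := by
  rw [integral_bipyramidWidth (p := fun _ r => r ^ 2 / 3 * r ^ 2) (by fun_prop) ha]
  have h1 : ∀ s : ℝ, (1 + 10 * s) ^ 2 / 3 * (1 + 10 * s) ^ 2 =
      1 / 3 + 40 / 3 * s + 200 * s ^ 2 + 4000 / 3 * s ^ 3 + 10000 / 3 * s ^ 4 :=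
    fun s => by ring
  have h2 : ∀ s : ℝ, (1 - s) ^ 2 / 3 * (1 - s) ^ 2 =
      1 / 3 + (-4 / 3) * s + 2 * s ^ 2 + (-4 / 3) * s ^ 3 + 1 / 3 * s ^ 4 := fun s => by ring
  simp only [h1, h2, integral_quartic]
  ring

/-- For every `d ≥ 3` there are convex bodies `K ⊆ L` in `ℝ^d` with
`det A(K) > det A(L)`. -/
theorem det_covMatrix_not_monotone_high_dim
    (d : ℕ) (hd : 3 ≤ d) :
    ∃ K L : Set (EuclideanSpace ℝ (Fin d)),
      IsConvexBody K ∧ IsConvexBody L ∧ K ⊆ L ∧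
      (covMatrix K).det > (covMatrix L).det := by
  obtain ⟨n, rfl⟩ : ∃ n, d = n + 3 := ⟨d - 3, by omega⟩
  refine ⟨boxTube (-1 / 20) 1 (bipyramidWidths n), boxTube (-1 / 10) 1 (bipyramidWidths n),
    isConvexBody_bipyramid n (by norm_num), isConvexBody_bipyramid n (by norm_num),
    fun x hx => ⟨⟨?_, hx.1.2⟩, hx.2⟩, ?_⟩
  · linarith [hx.1.1]
  have hV : ∀ a : ℝ, a < 0 → ∫ s in a..1, bipyramidWidth s ^ 2 =
      1 / 3 - (a + 10 * a ^ 2 + 100 * a ^ 3 / 3) := by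
    intro a ha
    have h := integral_quadratic_mul_bipyramidWidth_sq 1 0 0 ha
    simp only [zero_mul, add_zero, one_mul] at h
    rw [h]
    ring
  have hS : ∀ a : ℝ, a < 0 → ∫ s in a..1, s * bipyramidWidth s ^ 2 =
      1 / 12 - (a ^ 2 / 2 + 20 * a ^ 3 / 3 + 25 * a ^ 4) := by
    intro a ha
    have h := integral_quadratic_mul_bipyramidWidth_sq 0 1 0 ha
    simp only [zero_mul, add_zero, zero_add, one_mul] at h
    rw [h]
    ring
  have hT : ∀ a c : ℝ, a < 0 → ∫ s in a..1, (s - c) ^ 2 * bipyramidWidth s ^ 2 =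
      c ^ 2 / 3 - c / 6 + 1 / 30 - (c ^ 2 * a + (20 * c ^ 2 - 2 * c) * a ^ 2 / 2 +
        (100 * c ^ 2 - 40 * c + 1) * a ^ 3 / 3 + (20 - 200 * c) * a ^ 4 / 4 + 20 * a ^ 5) := by
    intro a c ha
    have hsq : ∀ s : ℝ, (s - c) ^ 2 = c ^ 2 + (-2 * c) * s + 1 * s ^ 2 := fun s => by ring
    simp only [hsq, integral_quadratic_mul_bipyramidWidth_sq _ _ _ ha]
    ring
  have hK : (-1 / 20 : ℝ) < 0 := by norm_num
  have hL : (-1 / 10 : ℝ) < 0 := by norm_num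
  rw [gt_iff_lt, det_covMatrix_bipyramid n hL le_rfl (by norm_num) (hV _ hL) (hS _ hL) (hT _ _ hL)
      (integral_bipyramidWidth_pow_four hL),
    det_covMatrix_bipyramid n hK (by norm_num) (by norm_num) (hV _ hK) (hS _ hK) (hT _ _ hK)
      (integral_bipyramidWidth_pow_four hK)]
  refine mul_lt_mul_of_pos_right ?_ (by positivity)
  norm_num
end

section
/- Let K be a d-dimensional convex body, let X_1,...,X_d be independent uniformly random points in K, and let μ(K) be the centroid of K. Then det A(K) = d!·E((vol conv{μ(K), X_1, ..., X_d})²), i.e., the determinant of the covariance matrix of K equals d! times the expected squared volume of the simplex spanned by the centroid and d independent uniform points in K. -/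
open MeasureTheory

/-- The corner simplex of size `r` has volume `r ^ n / n!`. -/
theorem volume_cornerSimplex (n : ℕ) (r : ℝ) (hr : 0 ≤ r) :
    volume {t : Fin n → ℝ | (∀ i, 0 ≤ t i) ∧ ∑ i, t i ≤ r} =
      ENNReal.ofReal (r ^ n / n.factorial) := by
  induction n generalizing r with
  | zero =>
    have : {t : Fin 0 → ℝ | (∀ i, 0 ≤ t i) ∧ ∑ i, t i ≤ r} = Set.univ := by
      ext t; simp [hr]
    rw [this, volume_pi, Measure.pi_univ]
    simp
  | succ n ih =>
    have hmeas : MeasurableSet {p : ℝ × (Fin n → ℝ) |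
        0 ≤ p.1 ∧ (∀ i, 0 ≤ p.2 i) ∧ p.1 + ∑ i, p.2 i ≤ r} := by
      refine IsClosed.measurableSet ?_
      simp only [Set.ofPred_and, Set.ofPred_forall]
      refine IsClosed.inter (isClosed_le (by fun_prop) (by fun_prop)) (IsClosed.inter
        (isClosed_iInter fun i => isClosed_le (by fun_prop) (by fun_prop))
        (isClosed_le (by fun_prop) (by fun_prop)))
    have hpre : {t : Fin (n + 1) → ℝ | (∀ i, 0 ≤ t i) ∧ ∑ i, t i ≤ r} =
        MeasurableEquiv.piFinSuccAbove (fun _ => ℝ) 0 ⁻¹' {p : ℝ × (Fin n → ℝ) |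
          0 ≤ p.1 ∧ (∀ i, 0 ≤ p.2 i) ∧ p.1 + ∑ i, p.2 i ≤ r} := by
      ext t
      simp [and_assoc, Fin.forall_fin_succ, Fin.sum_univ_succ, MeasurableEquiv.piFinSuccAbove,
        Fin.insertNthEquiv, Fin.tail]
    rw [hpre, (volume_preserving_piFinSuccAbove (fun _ => ℝ) 0).measure_preimage
      hmeas.nullMeasurableSet, Measure.volume_eq_prod, Measure.prod_apply hmeas]
    have hslice : ∀ x : ℝ, volume (Prod.mk x ⁻¹' {p : ℝ × (Fin n → ℝ) |
        0 ≤ p.1 ∧ (∀ i, 0 ≤ p.2 i) ∧ p.1 + ∑ i, p.2 i ≤ r}) =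
        (Set.Icc 0 r).indicator (fun x => ENNReal.ofReal ((r - x) ^ n / n.factorial)) x := by
      intro x
      by_cases hx : x ∈ Set.Icc 0 r
      · rw [Set.indicator_of_mem hx, ← ih (r - x) (by linarith [hx.2])]
        congr 1
        ext t
        simp [hx.1, le_sub_iff_add_le']
      · rw [Set.indicator_of_notMem hx]
        convert measure_empty (μ := (volume : Measure (Fin n → ℝ)))
        refine Set.eq_empty_of_forall_notMem fun t ht => hx ⟨ht.1, ?_⟩
        have := Finset.sum_nonneg fun i (_ : i ∈ Finset.univ) => ht.2.1 i
        linarith [ht.2.2]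
    simp_rw [hslice]
    rw [lintegral_indicator measurableSet_Icc, ← ofReal_integral_eq_lintegral_ofReal
      ((by fun_prop : Continuous fun x : ℝ => (r - x) ^ n / n.factorial).integrableOn_Icc)
      (ae_restrict_of_forall_mem measurableSet_Icc fun x hx =>
        div_nonneg (pow_nonneg (sub_nonneg.2 hx.2) n) (by positivity)),
      integral_Icc_eq_integral_Ioc, ← intervalIntegral.integral_of_le hr,
      intervalIntegral.integral_comp_sub_left (fun x => x ^ n / (n.factorial : ℝ)) r]
    congr 1
    simp [Nat.factorial_succ]
    field_simp

theorem convexHull_insert_zero_range_single (n : ℕ) :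
    convexHull ℝ (insert 0 (Set.range fun i : Fin n => Pi.single i (1 : ℝ))) =
      {t : Fin n → ℝ | (∀ i, 0 ≤ t i) ∧ ∑ i, t i ≤ 1} := by
  refine Set.Subset.antisymm (convexHull_min ?_ ?_) ?_
  · rintro _ (rfl | ⟨i, rfl⟩)
    · simp
    · refine ⟨fun j => ?_, by simp⟩
      by_cases h : j = i
      · subst h; simp
      · simp [h]
  · rintro x ⟨hx, hx'⟩ y ⟨hy, hy'⟩ a b ha hb hab
    refine ⟨fun i => add_nonneg (mul_nonneg ha (hx i)) (mul_nonneg hb (hy i)), ?_⟩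
    simp only [Pi.add_apply, Pi.smul_apply, smul_eq_mul, Finset.sum_add_distrib,
      ← Finset.mul_sum]
    nlinarith
  · rintro t ⟨ht, ht'⟩
    have h := (convex_convexHull ℝ (insert 0 (Set.range fun i : Fin n =>
      Pi.single i (1 : ℝ)))).sum_mem (t := Finset.univ)
      (w := fun o : Option (Fin n) => o.elim (1 - ∑ i, t i) t)
      (z := fun o => o.elim 0 fun i => Pi.single i 1)
      (by rintro (_ | i) _ <;> simp [ht, ht'])
      (by simp [Fintype.sum_option])
      (by
        rintro (_ | i) _
        · exact subset_convexHull _ _ (Set.mem_insert _ _)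
        · exact subset_convexHull _ _ (Set.mem_insert_of_mem _ ⟨i, rfl⟩))
    convert h
    ext j
    simp [Fintype.sum_option, Finset.sum_apply, Pi.single_apply]

/-- The volume of the simplex with vertices `c, X₀, …, X_{d-1}`. -/
theorem volume_convexHull_insert_range {d : ℕ} (c : EuclideanSpace ℝ (Fin d))
    (X : Fin d → EuclideanSpace ℝ (Fin d)) :
    (volume (convexHull ℝ (insert c (Set.range X)))).toReal =
      |(Matrix.of fun i j => X i j - c j).det| / d.factorial := by
  set M : Matrix (Fin d) (Fin d) ℝ := Matrix.of fun i j => X i j - c j with hM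
  have hset : WithLp.toLp 2 ⁻¹' convexHull ℝ (insert c (Set.range X)) =
      (fun v => c.ofLp + v) '' (Matrix.toLin' M.transpose ''
        {t : Fin d → ℝ | (∀ i, 0 ≤ t i) ∧ ∑ i, t i ≤ 1}) := by
    have h1 : WithLp.toLp 2 ⁻¹' convexHull ℝ (insert c (Set.range X)) =
        (WithLp.linearEquiv 2 ℝ (Fin d → ℝ)).toLinearMap ''
          convexHull ℝ (insert c (Set.range X)) := by
      ext v
      constructor
      · intro hv
        exact ⟨_, hv, rfl⟩
      · rintro ⟨w, hw, rfl⟩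
        exact hw
    rw [h1, LinearMap.image_convexHull, ← convexHull_insert_zero_range_single,
      LinearMap.image_convexHull]
    change _ = (fun v => c.ofLp +ᵥ v) '' _
    rw [Set.image_vadd, ← convexHull_vadd, ← Set.image_vadd]
    congr 1
    simp only [Set.image_insert_eq, ← Set.range_comp, map_zero, vadd_eq_add, add_zero]
    congr 2
    ext i j
    simp [hM]
  rw [← (PiLp.volume_preserving_toLp (Fin d)).measure_preimage_equiv
    (f := MeasurableEquiv.toLp 2 (Fin d → ℝ))]
  change (volume (WithLp.toLp 2 ⁻¹' convexHull ℝ (insert c (Set.range X)))).toReal = _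
  rw [hset, Set.image_add_left, measure_preimage_add, Measure.addHaar_image_linearMap,
    volume_cornerSimplex d 1 zero_le_one, LinearMap.det_toLin', Matrix.det_transpose,
    ENNReal.toReal_mul, ENNReal.toReal_ofReal (abs_nonneg _),
    ENNReal.toReal_ofReal (by positivity)]
  simp [div_eq_mul_inv]

theorem sum_perm_sum_perm_sign_mul_prod {R n : Type*} [CommRing R] [Fintype n] [DecidableEq n]
    (A : Matrix n n R) :
    ∑ σ : Equiv.Perm n, ∑ τ : Equiv.Perm n,
        ((Equiv.Perm.sign σ : ℤ) : R) * ((Equiv.Perm.sign τ : ℤ) : R) * ∏ i, A (σ i) (τ i) =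
      (Fintype.card n).factorial * A.det := by
  have h : ∀ σ : Equiv.Perm n, ∑ τ : Equiv.Perm n,
      ((Equiv.Perm.sign σ : ℤ) : R) * ((Equiv.Perm.sign τ : ℤ) : R) * ∏ i, A (σ i) (τ i) =
        A.det := by
    intro σ
    have h1 := Matrix.det_permute σ A
    rw [← Matrix.det_transpose, Matrix.det_apply'] at h1
    simp only [Matrix.transpose_apply, Matrix.submatrix_apply, id] at h1
    simp_rw [mul_assoc, ← Finset.mul_sum]
    rw [h1, ← mul_assoc, ← Int.cast_mul, ← Units.val_mul, Int.units_mul_self]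
    simp
  simp [h, Fintype.card_perm]

/-- The expected squared determinant of a matrix with independent identically distributed
rows is `d!` times the determinant of the second moment matrix of a row. -/
theorem average_sq_det_eq_factorial_mul_det {d : ℕ} (K : Set (EuclideanSpace ℝ (Fin d)))
    (hK : IsCompact K) (c : EuclideanSpace ℝ (Fin d)) :
    (⨍ X : Fin d → EuclideanSpace ℝ (Fin d) in Set.univ.pi (fun _ => K),
        (Matrix.of fun i j => X i j - c j).det ^ 2) =
      d.factorial *
        (Matrix.of fun i j => ⨍ x in K, (x i - c i) * (x j - c j)).det := by
  have hprod : ∀ σ τ : Equiv.Perm (Fin d),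
      (⨍ X : Fin d → EuclideanSpace ℝ (Fin d) in Set.univ.pi (fun _ => K),
        ∏ i, ((X i (σ i) - c (σ i)) * (X i (τ i) - c (τ i)))) =
      ∏ i, ⨍ x in K, (x (σ i) - c (σ i)) * (x (τ i) - c (τ i)) := by
    intro σ τ
    simp only [setAverage_eq, smul_eq_mul,
      Finset.prod_mul_distrib (f := fun _ => (volume.real K)⁻¹)]
    congr 1
    · simp [Measure.real, volume_pi_pi]
    · rw [volume_pi, Measure.restrict_pi_pi]
      exact integral_fintype_prod_eq_prod (μ := fun _ => volume.restrict K)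
        (fun i (x : EuclideanSpace ℝ (Fin d)) => (x (σ i) - c (σ i)) * (x (τ i) - c (τ i)))
  have hint : ∀ f : (Fin d → EuclideanSpace ℝ (Fin d)) → ℝ, Continuous f →
      IntegrableOn f (Set.univ.pi fun _ => K) := fun f hf =>
    hf.continuousOn.integrableOn_compact (isCompact_univ_pi fun _ => hK)
  have hexp : ∀ X : Fin d → EuclideanSpace ℝ (Fin d),
      (Matrix.of fun i j => X i j - c j).det ^ 2 =
        ∑ σ : Equiv.Perm (Fin d), ∑ τ : Equiv.Perm (Fin d),
          ((Equiv.Perm.sign σ : ℤ) : ℝ) * ((Equiv.Perm.sign τ : ℤ) : ℝ) *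
            ∏ i, ((X i (σ i) - c (σ i)) * (X i (τ i) - c (τ i))) := by
    intro X
    rw [← Matrix.det_transpose, Matrix.det_apply', sq, Finset.sum_mul_sum]
    refine Finset.sum_congr rfl fun σ _ => Finset.sum_congr rfl fun τ _ => ?_
    simp only [Matrix.transpose_apply, Matrix.of_apply, Finset.prod_mul_distrib]
    ring
  have hA := sum_perm_sum_perm_sign_mul_prod
    (Matrix.of fun i j => ⨍ x in K, (x i - c i) * (x j - c j))
  rw [Fintype.card_fin] at hA
  rw [← hA]
  simp only [Matrix.of_apply, ← hprod, hexp]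
  simp only [setAverage_eq, smul_eq_mul]
  rw [integral_finsetSum _ fun σ _ => hint _ (by fun_prop), Finset.mul_sum]
  refine Finset.sum_congr rfl fun σ _ => ?_
  rw [integral_finsetSum _ fun τ _ => hint _ (by fun_prop), Finset.mul_sum]
  refine Finset.sum_congr rfl fun τ _ => ?_
  rw [integral_const_mul]
  ring

/-- `det A(K) = d! · E((vol conv{μ(K), X₁, …, X_d})²)` where `X₁, …, X_d` are
independent uniformly random points in `K`. -/
theorem det_covMatrix_eq_factorial_mul_expected_sq_volume_with_centroid
    (d : ℕ) (K : Set (EuclideanSpace ℝ (Fin d))) (hK : IsConvexBody K) :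
    (covMatrix K).det =
      (d.factorial : ℝ) *
        ⨍ X : Fin d → EuclideanSpace ℝ (Fin d) in Set.univ.pi (fun _ => K),
          (volume (convexHull ℝ (insert (centroid K) (Set.range X)))).toReal ^ 2 := by
  have h := average_sq_det_eq_factorial_mul_det K hK.1 (centroid K)
  simp only [volume_convexHull_insert_range, div_pow, sq_abs]
  simp only [setAverage_eq, smul_eq_mul, integral_div] at h ⊢
  rw [← mul_div_assoc, h, covMatrix]
  simp only [setAverage_eq, smul_eq_mul]
  field_simp
end

section
/- Let K be a d-dimensional convex body. Then det A(K) = (d!/(d+1))·E(V_K²), where V_K is the volume of the convex hull of d+1 independent uniformly random points in K and A(K) is the covariance matrix of K. -/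
open MeasureTheory

/-- The volume of a corner simplex in `ℝ^n`. -/
theorem volume_nonneg_sum_le (n : ℕ) {t : ℝ} (ht : 0 ≤ t) :
    volume {x : Fin n → ℝ | (∀ i, 0 ≤ x i) ∧ ∑ i, x i ≤ t} =
      ENNReal.ofReal (t ^ n / n.factorial) := by
  induction n generalizing t with
  | zero => simp [ht, volume_pi, Measure.pi_of_empty (x := 0)]
  | succ n ih =>
    set s : Set (ℝ × (Fin n → ℝ)) := {p | 0 ≤ p.1 ∧ (∀ i, 0 ≤ p.2 i) ∧ p.1 + ∑ i, p.2 i ≤ t}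
    have hs : MeasurableSet s := by
      refine IsClosed.measurableSet ?_
      simp only [s, Set.ofPred_and, Set.ofPred_forall]
      exact (isClosed_le (by fun_prop) (by fun_prop)).inter
        ((isClosed_iInter fun i => isClosed_le (by fun_prop) (by fun_prop)).inter
          (isClosed_le (by fun_prop) (by fun_prop)))
    have hpre : {x : Fin (n + 1) → ℝ | (∀ i, 0 ≤ x i) ∧ ∑ i, x i ≤ t} =
        MeasurableEquiv.piFinSuccAbove (fun _ => ℝ) 0 ⁻¹' s := by
      ext x
      simp [s, Fin.forall_fin_succ, Fin.sum_univ_succ, Fin.tail, and_assoc]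
    have hslice (a : ℝ) : volume (Prod.mk a ⁻¹' s) =
        (Set.Icc 0 t).indicator (fun a => ENNReal.ofReal ((t - a) ^ n / n.factorial)) a := by
      by_cases ha : a ∈ Set.Icc 0 t
      · rw [Set.indicator_of_mem ha, ← ih (sub_nonneg.2 ha.2)]
        congr 1
        ext y
        simp [s, ha.1, le_sub_iff_add_le']
      · rw [Set.indicator_of_notMem ha]
        convert measure_empty (μ := volume)
        ext y
        simp only [s, Set.mem_preimage, Set.mem_ofPred_eq, Set.mem_empty_iff_false, iff_false]
        rintro ⟨h1, h2, h3⟩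
        exact ha ⟨h1, by linarith [Finset.sum_nonneg fun i (_ : i ∈ Finset.univ) => h2 i]⟩
    rw [hpre, (volume_preserving_piFinSuccAbove (fun _ => ℝ) 0).measure_preimage_equiv,
      Measure.volume_eq_prod, Measure.prod_apply hs]
    simp_rw [hslice]
    rw [lintegral_indicator measurableSet_Icc, ← ofReal_integral_eq_lintegral_ofReal]
    · rw [integral_Icc_eq_integral_Ioc, ← intervalIntegral.integral_of_le ht,
        intervalIntegral.integral_div,
        intervalIntegral.integral_comp_sub_left (fun a => a ^ n) t, sub_self, sub_zero,
        integral_pow, Nat.factorial_succ]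
      congr 1
      push_cast
      field_simp
      simp
    · exact (Continuous.integrableOn_Icc (by fun_prop))
    · filter_upwards [ae_restrict_mem measurableSet_Icc] with a ha
      have := sub_nonneg.2 ha.2
      positivity

/-- `stdSimplex` as the graph of the first barycentric coordinate over the other ones. -/
theorem stdSimplex_fin_succ_eq_image (d : ℕ) :
    stdSimplex ℝ (Fin (d + 1)) =
      (fun y : Fin d → ℝ => (Fin.cons (1 - ∑ i, y i) y : Fin (d + 1) → ℝ)) ''
        {y | (∀ i, 0 ≤ y i) ∧ ∑ i, y i ≤ 1} := by
  ext w
  constructor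
  · rintro ⟨h0, h1⟩
    rw [Fin.sum_univ_succ] at h1
    have hw : 1 - ∑ i, Fin.tail w i = w 0 := sub_eq_of_eq_add h1.symm
    refine ⟨Fin.tail w, ⟨fun i => h0 _, sub_nonneg.1 (hw ▸ h0 0)⟩, ?_⟩
    simp only [hw, Fin.cons_self_tail]
  · rintro ⟨y, ⟨h0, h1⟩, rfl⟩
    refine ⟨Fin.forall_fin_succ.2 ⟨by simpa using h1, by simpa using h0⟩, ?_⟩
    simp [Fin.sum_univ_succ]

theorem convexHull_range_eq_image_stdSimplex {ι E : Type*} [Fintype ι] [AddCommGroup E]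
    [Module ℝ E] (X : ι → E) :
    convexHull ℝ (Set.range X) = Fintype.linearCombination ℝ X '' stdSimplex ℝ ι := by
  classical
  rw [← convexHull_rangle_single_eq_stdSimplex, LinearMap.image_convexHull, ← Set.range_comp]
  congr 2
  ext i
  simp

/-- The volume of a (possibly degenerate) simplex in `ℝ^d` with vertices `X 0, …, X d`. -/
theorem volume_convexHull_range {d : ℕ} (X : Fin (d + 1) → EuclideanSpace ℝ (Fin d)) :
    volume (convexHull ℝ (Set.range X)) =
      ENNReal.ofReal (|(Matrix.of fun i j => X (Fin.succ i) j - X 0 j).det| / d.factorial) := by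
  set M : Matrix (Fin d) (Fin d) ℝ := Matrix.of fun i j => X (Fin.succ i) j - X 0 j
  have h : convexHull ℝ (Set.range X) = WithLp.ofLp ⁻¹'
      ((fun z => z + WithLp.ofLp (X 0)) '' (Matrix.toLin' M.transpose ''
        {y | (∀ i, 0 ≤ y i) ∧ ∑ i, y i ≤ 1})) := by
    rw [convexHull_range_eq_image_stdSimplex, stdSimplex_fin_succ_eq_image, Set.image_image,
      Set.image_image]
    refine Eq.trans ?_ ((WithLp.equiv 2 (Fin d → ℝ)).image_symm_eq_preimage _)
    rw [Set.image_image]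
    refine Set.image_congr fun y _ => ?_
    ext j
    simp [Fintype.linearCombination_apply, Fin.sum_univ_succ, M, Matrix.mulVec, dotProduct,
      sub_mul, mul_comm, mul_sub]
    rw [← Finset.sum_mul]
    ring
  have e (s : Set (Fin d → ℝ)) :
      volume ((WithLp.ofLp : EuclideanSpace ℝ (Fin d) → Fin d → ℝ) ⁻¹' s) = volume s :=
    (PiLp.volume_preserving_ofLp (Fin d)).measure_preimage_equiv
      (f := (MeasurableEquiv.toLp 2 (Fin d → ℝ)).symm) s
  rw [h, e, Set.image_add_right, measure_preimage_add_right, Measure.addHaar_image_linearMap,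
    volume_nonneg_sum_le d zero_le_one, LinearMap.det_toLin', Matrix.det_transpose,
    ← ENNReal.ofReal_mul (abs_nonneg _), one_pow, mul_one_div]

/-- Andréief's identity, for the square of a single determinant. -/
theorem integral_det_sq_pi {n E : Type*} [Fintype n] [DecidableEq n] [MeasurableSpace E]
    (μ : Measure E) [SigmaFinite μ] (f : n → E → ℝ)
    (hf : ∀ i j, Integrable (fun x => f i x * f j x) μ) :
    ∫ X : n → E, (Matrix.of fun i j => f j (X i)).det ^ 2 ∂Measure.pi (fun _ => μ) =
      (Fintype.card n).factorial * (Matrix.of fun i j => ∫ x, f i x * f j x ∂μ).det := by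
  have hexp (X : n → E) : (Matrix.of fun i j => f j (X i)).det ^ 2 =
      ∑ σ : Equiv.Perm n, ∑ τ : Equiv.Perm n, (σ.sign : ℝ) * (τ.sign : ℝ) *
        ∏ i, (f (σ i) (X i) * f (τ i) (X i)) := by
    rw [← Matrix.det_transpose, Matrix.det_apply', sq, Finset.sum_mul_sum]
    refine Finset.sum_congr rfl fun σ _ => Finset.sum_congr rfl fun τ _ => ?_
    simp only [Matrix.transpose_apply, Matrix.of_apply, Finset.prod_mul_distrib]
    ring
  have hint (σ τ : Equiv.Perm n) : Integrable (fun X : n → E => (σ.sign : ℝ) * (τ.sign : ℝ) *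
        ∏ i, (f (σ i) (X i) * f (τ i) (X i))) (Measure.pi fun _ => μ) :=
    (Integrable.fintype_prod (f := fun i x => f (σ i) x * f (τ i) x)
      fun i => hf (σ i) (τ i)).const_mul _
  simp_rw [hexp]
  rw [integral_finsetSum _ fun σ _ => integrable_finsetSum _ fun τ _ => hint σ τ]
  set S : Matrix n n ℝ := Matrix.of fun i j => ∫ x, f i x * f j x ∂μ
  have hσ (σ : Equiv.Perm n) : ∫ X : n → E, ∑ τ : Equiv.Perm n, (σ.sign : ℝ) * (τ.sign : ℝ) *
        ∏ i, (f (σ i) (X i) * f (τ i) (X i)) ∂(Measure.pi fun _ => μ) = S.det := by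
    rw [integral_finsetSum _ fun τ _ => hint σ τ]
    have hrow : (S.submatrix σ id).det = σ.sign * S.det := Matrix.det_permute σ S
    have hsign : (σ.sign : ℝ) * σ.sign = 1 := by
      rcases Int.units_eq_one_or σ.sign with h | h <;> simp [h]
    calc _ = (σ.sign : ℝ) * (S.submatrix σ id).det := by
          rw [← Matrix.det_transpose, Matrix.det_apply', Finset.mul_sum]
          refine Finset.sum_congr rfl fun τ _ => ?_
          rw [integral_const_mul, mul_assoc,
            integral_fintype_prod_eq_prod (fun i x => f (σ i) x * f (τ i) x)]
          simp [S]
      _ = S.det := by rw [hrow, ← mul_assoc, hsign, one_mul]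
  simp [hσ, Fintype.card_perm]

/-- Subtracting the first row from the others in a matrix with first column `1`. -/
theorem det_cons_one_eq {R : Type*} [CommRing R] {d : ℕ} (u : Fin (d + 1) → Fin d → R) :
    (Matrix.of fun i j => (Fin.cons 1 (u i) : Fin (d + 1) → R) j).det =
      (Matrix.of fun i j => u (Fin.succ i) j - u 0 j).det := by
  rw [Matrix.det_eq_of_forall_row_eq_smul_add_const
    (B := Matrix.of fun i j =>
      if i = 0 then (Fin.cons 1 (u 0) : Fin (d + 1) → R) j
      else (Fin.cons 1 (u i) : Fin (d + 1) → R) j - (Fin.cons 1 (u 0) : Fin (d + 1) → R) j)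
    (fun i => if i = 0 then 0 else 1) 0 (by simp), Matrix.det_succ_column_zero,
    Fin.sum_univ_succ]
  · simp [Matrix.submatrix, Fin.succ_ne_zero]
  · intro i j
    by_cases hi : i = 0 <;> simp [hi]

theorem setIntegral_sub_centroid {d : ℕ} {K : Set (EuclideanSpace ℝ (Fin d))} (hK : IsCompact K)
    (i : Fin d) : ∫ x in K, (x i - centroid K i) = 0 := by
  have : IsFiniteMeasure (volume.restrict K) := isFiniteMeasure_restrict.2 hK.measure_lt_top.ne
  have hid : IntegrableOn (fun x : EuclideanSpace ℝ (Fin d) => x) K :=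
    continuous_id.continuousOn.integrableOn_compact hK
  have h := (EuclideanSpace.proj (𝕜 := ℝ) i).integral_comp_comm
    (hid.sub (integrable_const (centroid K)))
  simpa [centroid, integral_sub_average] using h

/-- `det A(K) = (d!/(d+1)) · E(V_K²)`, where `V_K` is the volume of the convex
hull of `d+1` independent uniformly random points in `K`. -/
theorem det_covMatrix_eq_expected_sq_simplex_volume
    (d : ℕ) (K : Set (EuclideanSpace ℝ (Fin d))) (hK : IsConvexBody K) :
    (covMatrix K).det =
      ((d.factorial : ℝ) / (d + 1)) *
        ⨍ X : Fin (d + 1) → EuclideanSpace ℝ (Fin d) in Set.univ.pi (fun _ => K),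
          (volume (convexHull ℝ (Set.range X))).toReal ^ 2 := by
  obtain ⟨hc, -, hne⟩ := hK
  have : IsFiniteMeasure (volume.restrict K) := isFiniteMeasure_restrict.2 hc.measure_lt_top.ne
  set v : ℝ := volume.real K with hv_def
  have hv : v ≠ 0 := (ENNReal.toReal_pos (Measure.measure_pos_of_nonempty_interior _ hne).ne'
    hc.measure_lt_top.ne).ne'
  let f : Fin (d + 1) → EuclideanSpace ℝ (Fin d) → ℝ := fun j x =>
    (Fin.cons 1 (fun i => x i - centroid K i) : Fin (d + 1) → ℝ) j
  have hfc (j : Fin (d + 1)) : Continuous (f j) := by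
    refine Fin.cases ?_ (fun i => ?_) j
    · simpa [f] using continuous_const
    · simp only [f, Fin.cons_succ]
      fun_prop
  have hvol (X : Fin (d + 1) → EuclideanSpace ℝ (Fin d)) :
      (volume (convexHull ℝ (Set.range X))).toReal ^ 2 =
        ((d.factorial : ℝ) ^ 2)⁻¹ * (Matrix.of fun i j => f j (X i)).det ^ 2 := by
    rw [volume_convexHull_range, ENNReal.toReal_ofReal (by positivity), div_pow, sq_abs,
      det_cons_one_eq fun i j => X i j - centroid K j]
    simp [div_eq_inv_mul]
  have hcov : (Matrix.of fun i j => ∫ x in K, f i x * f j x).det =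
      v ^ (d + 1) * (covMatrix K).det := by
    have hsub : (Matrix.of fun i j => ∫ x in K, f i x * f j x).submatrix Fin.succ Fin.succ =
        v • covMatrix K := by
      ext i j
      simp [f, covMatrix, setAverage_eq, ← hv_def, hv]
    rw [Matrix.det_succ_row_zero, Fin.sum_univ_succ, Finset.sum_eq_zero fun i _ => ?_]
    · simp only [Fin.succAbove_zero, hsub]
      simp [f, ← hv_def, pow_succ']
      ring
    · simp [f, setIntegral_sub_centroid hc]
  have hpi : volume.restrict (Set.univ.pi fun _ : Fin (d + 1) => K) =
      Measure.pi fun _ => volume.restrict K := by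
    rw [volume_pi, Measure.restrict_pi_pi]
  have hvpi : (volume.real (Set.univ.pi fun _ : Fin (d + 1) => K)) = v ^ (d + 1) := by
    simp [Measure.real, volume_pi, Measure.pi_pi, v]
  simp_rw [setAverage_eq, hvol, hpi, hvpi]
  rw [integral_const_mul, integral_det_sq_pi _ f fun i j =>
      (((hfc i).mul (hfc j)).continuousOn.integrableOn_compact hc), hcov, Fintype.card_fin,
      Nat.factorial_succ, smul_eq_mul]
  push_cast
  field_simp
end

section
/- Fix a dimension d. The following are equivalent: (i) for every pair of convex bodies K ⊆ L ⊆ ℝ^d one has det A(K) ≤ det A(L); (ii) every isotropic convex body K ⊆ ℝ^d contains the closed Euclidean ball of radius √d centered at the origin. -/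
open MeasureTheory

/-- `K` is isotropic: its centroid is the origin and its covariance matrix is
the identity. -/
def IsIsotropic {d : ℕ} (K : Set (EuclideanSpace ℝ (Fin d))) : Prop :=
  centroid K = 0 ∧ covMatrix K = 1

open Filter Topology Matrix Set

namespace IsConvexBody

variable {d : ℕ} {K : Set (EuclideanSpace ℝ (Fin d))}

lemma measurableSet (hK : IsConvexBody K) : MeasurableSet K := hK.1.measurableSet

lemma nonempty (hK : IsConvexBody K) : K.Nonempty := hK.2.2.mono interior_subset

lemma volume_ne_zero (hK : IsConvexBody K) : volume K ≠ 0 :=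
  (Measure.measure_pos_of_nonempty_interior _ hK.2.2).ne'

lemma volume_ne_top (hK : IsConvexBody K) : volume K ≠ ⊤ := hK.1.measure_lt_top.ne

lemma volume_real_pos (hK : IsConvexBody K) : 0 < volume.real K :=
  ENNReal.toReal_pos hK.volume_ne_zero hK.volume_ne_top

lemma integrableOn (hK : IsConvexBody K) {F : Type*} [NormedAddCommGroup F]
    {g : EuclideanSpace ℝ (Fin d) → F} (hg : Continuous g) : IntegrableOn g K :=
  hg.continuousOn.integrableOn_compact hK.1

lemma integrable_uniform (hK : IsConvexBody K) {F : Type*} [NormedAddCommGroup F]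
    {g : EuclideanSpace ℝ (Fin d) → F} (hg : Continuous g) :
    Integrable g ((volume K)⁻¹ • volume.restrict K) :=
  (hK.integrableOn hg).smul_measure (ENNReal.inv_ne_top.2 hK.volume_ne_zero)

lemma isProbabilityMeasure (hK : IsConvexBody K) :
    IsProbabilityMeasure ((volume K)⁻¹ • volume.restrict K) :=
  ⟨by simp [ENNReal.inv_mul_cancel hK.volume_ne_zero hK.volume_ne_top]⟩

lemma centroid_apply (hK : IsConvexBody K) (i : Fin d) :
    centroid K i = ⨍ x in K, x i := by
  rw [centroid, setAverage_eq', setAverage_eq']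
  exact ((EuclideanSpace.proj i : EuclideanSpace ℝ (Fin d) →L[ℝ] ℝ).integral_comp_comm
    (hK.integrable_uniform continuous_id)).symm

lemma setAverage_sub_mul_sub_eq (hK : IsConvexBody K) (i j : Fin d) (a b : ℝ) :
    ⨍ x in K, (x i - a) * (x j - b) =
      (⨍ x in K, x i * x j) - b * centroid K i - a * centroid K j + a * b := by
  have := hK.isProbabilityMeasure
  have h1 : Integrable (fun x : EuclideanSpace ℝ (Fin d) => x i * x j)
    ((volume K)⁻¹ • volume.restrict K) := hK.integrable_uniform (by fun_prop)
  have h2 : Integrable (fun x : EuclideanSpace ℝ (Fin d) => b * x i)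
    ((volume K)⁻¹ • volume.restrict K) := hK.integrable_uniform (by fun_prop)
  have h3 : Integrable (fun x : EuclideanSpace ℝ (Fin d) => a * x j)
    ((volume K)⁻¹ • volume.restrict K) := hK.integrable_uniform (by fun_prop)
  rw [hK.centroid_apply, hK.centroid_apply]
  simp only [setAverage_eq']
  have e : ∀ x : EuclideanSpace ℝ (Fin d), (x i - a) * (x j - b)
      = x i * x j - b * x i - a * x j + a * b := fun x => by ring
  simp_rw [e]
  have h12 := h1.sub h2
  have h123 := h12.sub h3
  simp only [Pi.sub_def] at h12 h123
  rw [integral_add h123 (integrable_const _), integral_sub h12 h3, integral_sub h1 h2,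
    integral_const_mul, integral_const_mul]
  simp

lemma covMatrix_apply (hK : IsConvexBody K) (i j : Fin d) :
    covMatrix K i j = (⨍ x in K, x i * x j) - centroid K i * centroid K j := by
  rw [covMatrix, Matrix.of_apply, hK.setAverage_sub_mul_sub_eq]
  ring

lemma setAverage_sub_mul_sub (hK : IsConvexBody K) (i j : Fin d) (a b : ℝ) :
    ⨍ x in K, (x i - a) * (x j - b) =
      covMatrix K i j + (centroid K i - a) * (centroid K j - b) := by
  rw [hK.setAverage_sub_mul_sub_eq, hK.covMatrix_apply]
  ring

lemma covMatrix_comm (K : Set (EuclideanSpace ℝ (Fin d))) (i j : Fin d) :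
    covMatrix K i j = covMatrix K j i := by
  simp [covMatrix, mul_comm]

end IsConvexBody

/-- The quadratic form `z ↦ zᵀ P z` of a matrix `P`. -/
def quadForm {d : ℕ} (P : Matrix (Fin d) (Fin d) ℝ) (z : EuclideanSpace ℝ (Fin d)) : ℝ :=
  z.ofLp ⬝ᵥ P *ᵥ z.ofLp

section quadForm

variable {d : ℕ} {K L : Set (EuclideanSpace ℝ (Fin d))}

lemma quadForm_eq_sum (P : Matrix (Fin d) (Fin d) ℝ) (z : EuclideanSpace ℝ (Fin d)) :
    quadForm P z = ∑ i, ∑ j, P i j * (z i * z j) := by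
  simp only [quadForm, dotProduct, mulVec, Finset.mul_sum]
  exact Finset.sum_congr rfl fun i _ => Finset.sum_congr rfl fun j _ => by ring

@[fun_prop]
lemma continuous_quadForm (P : Matrix (Fin d) (Fin d) ℝ) : Continuous (quadForm P) := by
  simp_rw [funext (quadForm_eq_sum P)]
  fun_prop

lemma setAverage_quadForm (hK : IsConvexBody K) (P : Matrix (Fin d) (Fin d) ℝ)
    (m : EuclideanSpace ℝ (Fin d)) :
    ⨍ x in K, quadForm P (x - m) = (P * covMatrix K).trace + quadForm P (centroid K - m) := by
  have key : ⨍ x in K, quadForm P (x - m) =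
      ∑ i, ∑ j, P i j * ⨍ x in K, (x i - m i) * (x j - m j) := by
    simp_rw [quadForm_eq_sum, setAverage_eq']
    rw [integral_finsetSum]
    · refine Finset.sum_congr rfl fun i _ => ?_
      rw [integral_finsetSum]
      · refine Finset.sum_congr rfl fun j _ => ?_
        rw [integral_const_mul]
        rfl
      · exact fun j _ => hK.integrable_uniform (by fun_prop)
    · exact fun j _ => hK.integrable_uniform (by fun_prop)
  rw [key, quadForm_eq_sum, trace, ← Finset.sum_add_distrib]
  refine Finset.sum_congr rfl fun i _ => ?_
  rw [diag_apply, mul_apply, ← Finset.sum_add_distrib]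
  refine Finset.sum_congr rfl fun j _ => ?_
  rw [hK.setAverage_sub_mul_sub, IsConvexBody.covMatrix_comm K i j, mul_add]
  rfl

lemma setAverage_dotProduct_sq (hK : IsConvexBody K) (v : Fin d → ℝ)
    (m : EuclideanSpace ℝ (Fin d)) :
    ⨍ x in K, (v ⬝ᵥ (x - m).ofLp) ^ 2 =
      v ⬝ᵥ covMatrix K *ᵥ v + (v ⬝ᵥ (centroid K - m).ofLp) ^ 2 := by
  have h : ∀ z : EuclideanSpace ℝ (Fin d), (v ⬝ᵥ z.ofLp) ^ 2 = quadForm (vecMulVec v v) z := by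
    intro z
    rw [quadForm, vecMulVec_mulVec]
    simp [dotProduct_smul, dotProduct_comm z.ofLp v, sq]
  simp_rw [h]
  rw [setAverage_quadForm hK, vecMulVec_mul, trace_vecMulVec, dotProduct_comm v (v ᵥ* _),
    ← dotProduct_mulVec]

lemma covMatrix_posDef (hK : IsConvexBody K) : (covMatrix K).PosDef := by
  refine Matrix.PosDef.of_dotProduct_mulVec_pos ?_ fun v hv => ?_
  · ext i j
    simpa using IsConvexBody.covMatrix_comm K j i
  have h := setAverage_dotProduct_sq hK v (centroid K)
  simp only [sub_self, WithLp.ofLp_zero, dotProduct_zero, ne_eq, OfNat.ofNat_ne_zero,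
    not_false_eq_true, zero_pow, add_zero] at h
  rw [star_trivial, ← h, setAverage_eq, smul_eq_mul]
  refine mul_pos (inv_pos.2 hK.volume_real_pos) ?_
  have hc : Continuous fun x : EuclideanSpace ℝ (Fin d) => (v ⬝ᵥ (x - centroid K).ofLp) ^ 2 := by
    simp only [dotProduct]; fun_prop
  rw [setIntegral_pos_iff_support_of_nonneg_ae (ae_of_all _ fun _ => sq_nonneg _)
    (hK.integrableOn hc)]
  have hopen : IsOpen ((Function.support fun x : EuclideanSpace ℝ (Fin d) =>
      (v ⬝ᵥ (x - centroid K).ofLp) ^ 2) ∩ interior K) :=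
    hc.isOpen_support.inter isOpen_interior
  refine (hopen.measure_pos volume ?_).trans_le
    (measure_mono (inter_subset_inter_right _ interior_subset))
  obtain ⟨x, hx⟩ := hK.2.2
  by_cases hx0 : v ⬝ᵥ (x - centroid K).ofLp = 0
  · have hcont : Tendsto (fun t : ℝ => x + t • WithLp.toLp 2 v) (𝓝[≠] 0) (𝓝 x) := by
      have : Continuous (fun t : ℝ => x + t • WithLp.toLp 2 v) := by fun_prop
      exact (this.tendsto' 0 x (by simp)).mono_left nhdsWithin_le_nhds
    obtain ⟨t, ht, ht0⟩ := ((hcont.eventually (isOpen_interior.mem_nhds hx)).and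
      self_mem_nhdsWithin).exists
    refine ⟨_, ?_, ht⟩
    have : v ⬝ᵥ (x + t • WithLp.toLp 2 v - centroid K).ofLp = t * (v ⬝ᵥ v) := by
      rw [add_sub_right_comm, WithLp.ofLp_add, dotProduct_add, hx0]
      simp
    simp only [Function.mem_support, this]
    have : v ⬝ᵥ v ≠ 0 := by simpa using hv
    exact pow_ne_zero _ (mul_ne_zero ht0 this)
  · exact ⟨x, by simpa using hx0, hx⟩

/-- The log-determinant lies below its tangent planes. -/
lemma log_det_sub_log_det_le {A B : Matrix (Fin d) (Fin d) ℝ} (hA : A.PosDef) (hB : B.PosDef) :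
    Real.log A.det - Real.log B.det ≤ (B⁻¹ * A).trace - d := by
  open scoped MatrixOrder in
  obtain ⟨C, hCu, hC⟩ := CStarAlgebra.isStrictlyPositive_iff_eq_star_mul_self.mp
    hB.inv.isStrictlyPositive
  rw [star_eq_conjTranspose] at hC
  have hS : (C * A * Cᴴ).PosDef := hA.mul_mul_conjTranspose_same
    (Matrix.vecMul_injective_iff_isUnit.2 hCu)
  have htr : (B⁻¹ * A).trace = (C * A * Cᴴ).trace := by
    rw [hC, Matrix.mul_assoc, trace_mul_comm]
  have hdet : (C * A * Cᴴ).det = A.det / B.det := by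
    have h1 : (B⁻¹).det = Cᴴ.det * C.det := by rw [hC, det_mul]
    rw [det_nonsing_inv, Ring.inverse_eq_inv'] at h1
    rw [det_mul, det_mul, div_eq_mul_inv, h1]
    ring
  rw [← Real.log_div hA.det_pos.ne' hB.det_pos.ne', ← hdet, htr,
    hS.isHermitian.det_eq_prod_eigenvalues, hS.isHermitian.trace_eq_sum_eigenvalues]
  simp only [RCLike.ofReal_real_eq_id, id_eq]
  rw [Real.log_prod fun i _ => (hS.eigenvalues_pos i).ne']
  calc _ ≤ ∑ i, (hS.isHermitian.eigenvalues i - 1) :=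
        Finset.sum_le_sum fun i _ => Real.log_le_sub_one_of_pos (hS.eigenvalues_pos i)
    _ = _ := by simp [Finset.sum_sub_distrib]

lemma quadForm_nonneg {P : Matrix (Fin d) (Fin d) ℝ} (hP : P.PosSemidef)
    (z : EuclideanSpace ℝ (Fin d)) : 0 ≤ quadForm P z := by
  simpa [quadForm] using hP.dotProduct_mulVec_nonneg z.ofLp

/-- The squared Mahalanobis distance of `x` from the centroid of `K`. -/
noncomputable def mahalanobisSq (K : Set (EuclideanSpace ℝ (Fin d)))
    (x : EuclideanSpace ℝ (Fin d)) : ℝ :=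
  quadForm (covMatrix K)⁻¹ (x - centroid K)

@[fun_prop]
lemma continuous_mahalanobisSq (K : Set (EuclideanSpace ℝ (Fin d))) :
    Continuous (mahalanobisSq K) := by
  unfold mahalanobisSq; fun_prop

lemma integral_mahalanobisSq_sub_self (hK : IsConvexBody K) :
    ∫ x in K, (mahalanobisSq K x - d) = 0 := by
  have h := setAverage_quadForm hK (covMatrix K)⁻¹ (centroid K)
  rw [Matrix.nonsing_inv_mul _ ((Matrix.isUnit_iff_isUnit_det _).1 (covMatrix_posDef hK).isUnit),
    setAverage_eq, smul_eq_mul, inv_mul_eq_iff_eq_mul₀ hK.volume_real_pos.ne'] at h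
  rw [integral_sub (hK.integrableOn (by fun_prop)) (hK.integrableOn (by fun_prop))]
  simp only [mahalanobisSq, h]
  simp [quadForm]

lemma volume_mul_log_det_sub_log_det_le (hK : IsConvexBody K) (hL : IsConvexBody L) :
    volume.real L * (Real.log (covMatrix L).det - Real.log (covMatrix K).det) ≤
      ∫ x in L, (mahalanobisSq K x - d) := by
  have h := setAverage_quadForm hL (covMatrix K)⁻¹ (centroid K)
  rw [setAverage_eq, smul_eq_mul, inv_mul_eq_iff_eq_mul₀ hL.volume_real_pos.ne'] at h
  rw [integral_sub (hL.integrableOn (by fun_prop)) (hL.integrableOn (by fun_prop))]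
  simp only [mahalanobisSq, h]
  rw [setIntegral_const, smul_eq_mul, ← mul_sub]
  refine mul_le_mul_of_nonneg_left ?_ hL.volume_real_pos.le
  have h1 := log_det_sub_log_det_le (covMatrix_posDef hL) (covMatrix_posDef hK)
  have h2 := quadForm_nonneg (covMatrix_posDef hK).inv.posSemidef (centroid L - centroid K)
  linarith

end quadForm

section Monotone

variable {d : ℕ} {K L : Set (EuclideanSpace ℝ (Fin d))}

lemma IsConvexBody.convexHull_insert (hK : IsConvexBody K) (x : EuclideanSpace ℝ (Fin d)) :
    IsConvexBody (convexHull ℝ (insert x K)) := by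
  refine ⟨?_, convex_convexHull _ _, hK.2.2.mono (interior_mono
    ((subset_insert _ _).trans (subset_convexHull _ _)))⟩
  have h : convexHull ℝ (insert x K) =
      (fun p : ℝ × EuclideanSpace ℝ (Fin d) => AffineMap.lineMap x p.2 p.1) ''
        (Icc (0 : ℝ) 1 ×ˢ K) := by
    rw [_root_.convexHull_insert hK.nonempty, hK.2.1.convexHull_eq]
    ext y
    simp only [convexJoin_singleton_left, mem_iUnion, segment_eq_image_lineMap, mem_image,
      mem_prod, Prod.exists]
    constructor
    · rintro ⟨k, hk, t, ht, rfl⟩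
      exact ⟨t, k, ⟨ht, hk⟩, rfl⟩
    · rintro ⟨t, k, ⟨ht, hk⟩, rfl⟩
      exact ⟨k, hk, t, ht, rfl⟩
  rw [h]
  refine (isCompact_Icc.prod hK.1).image ?_
  simp only [AffineMap.lineMap_apply_module]
  fun_prop

/-- A small cap of the hull of a convex body and an outer point `x` can be cut off near `x`. -/
lemma IsConvexBody.exists_cap (hK : IsConvexBody K) {x : EuclideanSpace ℝ (Fin d)} (hx : x ∉ K)
    {ε : ℝ} (hε : 0 < ε) :
    ∃ K', IsConvexBody K' ∧ K ⊆ K' ∧ K' ⊆ convexHull ℝ (insert x K) ∧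
      0 < volume (convexHull ℝ (insert x K) \ K') ∧
      ∀ y ∈ convexHull ℝ (insert x K) \ K', dist y x < ε := by
  have hL := hK.convexHull_insert x
  set L := convexHull ℝ (insert x K) with hLdef
  have hKL : K ⊆ L := (subset_insert _ _).trans (subset_convexHull _ _)
  have hxL : x ∈ L := subset_convexHull _ _ (mem_insert _ _)
  obtain ⟨f, u, hfK, hfx⟩ := geometric_hahn_banach_closed_point hK.2.1 hK.1.isClosed hx
  obtain ⟨D, hD⟩ := hK.1.isBounded.subset_closedBall x
  have hD1 : 0 < |D| + 1 := by positivity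
  have hu : 0 < f x - u := sub_pos.2 hfx
  set δ := min (f x - u) (ε * (f x - u) / (|D| + 1)) with hδ
  have hδ0 : 0 < δ := lt_min hu (by positivity)
  have hδu : δ ≤ f x - u := min_le_left _ _
  have hδε : δ ≤ ε * (f x - u) / (|D| + 1) := min_le_right _ _
  have hsub : K ⊆ L ∩ {y | f y ≤ f x - δ} := fun k hk =>
    ⟨hKL hk, by have := hfK k hk; simp only [mem_ofPred_eq]; linarith⟩
  refine ⟨L ∩ {y | f y ≤ f x - δ}, ⟨?_, ?_, ?_⟩, hsub, inter_subset_left, ?_, ?_⟩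
  · exact hL.1.inter_right (isClosed_le f.continuous continuous_const)
  · exact hL.2.1.inter (convex_halfSpace_le f.toLinearMap.isLinear _)
  · exact hK.2.2.mono (interior_mono hsub)
  · have ho : IsOpen ({y | f x - δ < f y} ∩ interior L) :=
      (isOpen_lt continuous_const f.continuous).inter isOpen_interior
    refine (ho.measure_pos volume ?_).trans_le (measure_mono ?_)
    · have hcl : x ∈ closure (interior L) := by
        rw [hL.2.1.closure_interior_eq_closure_of_nonempty_interior hL.2.2]
        exact subset_closure hxL
      exact mem_closure_iff.1 hcl _ (isOpen_lt continuous_const f.continuous)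
        (by simp only [mem_ofPred_eq]; linarith)
    · rintro y ⟨hy, hyL⟩
      exact ⟨interior_subset hyL, fun h => absurd (show f y ≤ f x - δ from h.2) (not_le.2 hy)⟩
  · rintro y ⟨hyL, hy⟩
    have hy' : f x - δ < f y := by
      by_contra h
      exact hy ⟨hyL, not_lt.1 h⟩
    rw [hLdef, _root_.convexHull_insert hK.nonempty, hK.2.1.convexHull_eq,
      convexJoin_singleton_left] at hyL
    simp only [mem_iUnion] at hyL
    obtain ⟨k, hk, a, b, ha, hb, hab, rfl⟩ := hyL
    have hkD : ‖k - x‖ ≤ |D| := by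
      have := hD hk
      rw [mem_closedBall_iff_norm] at this
      exact this.trans (le_abs_self D)
    obtain rfl : a = 1 - b := by linarith
    have e : (1 - b) • x + b • k - x = b • (k - x) := by module
    rw [dist_eq_norm, e, norm_smul, Real.norm_of_nonneg hb]
    simp only [map_add, map_smul, smul_eq_mul] at hy'
    have h1 : b * (f x - u) < δ := by nlinarith [hfK k hk]
    have h2 : b * (|D| + 1) < ε := by
      rw [le_div_iff₀ hD1] at hδε
      nlinarith
    nlinarith

lemma log_det_covMatrix_le_of_forall (hmono : ∀ K L : Set (EuclideanSpace ℝ (Fin d)),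
      IsConvexBody K → IsConvexBody L → K ⊆ L → (covMatrix K).det ≤ (covMatrix L).det)
    (hK : IsConvexBody K) (hL : IsConvexBody L) (h : K ⊆ L) :
    Real.log (covMatrix K).det ≤ Real.log (covMatrix L).det :=
  Real.log_le_log (covMatrix_posDef hK).det_pos (hmono K L hK hL h)

lemma exists_le_mahalanobisSq (hmono : ∀ K L : Set (EuclideanSpace ℝ (Fin d)),
      IsConvexBody K → IsConvexBody L → K ⊆ L → (covMatrix K).det ≤ (covMatrix L).det)
    (hK : IsConvexBody K) {x : EuclideanSpace ℝ (Fin d)} (hx : x ∉ K) {ε : ℝ} (hε : 0 < ε) :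
    ∃ K' y, IsConvexBody K' ∧ K ⊆ K' ∧ K' ⊆ convexHull ℝ (insert x K) ∧ dist y x < ε ∧
      (d : ℝ) ≤ mahalanobisSq K' y := by
  obtain ⟨K', hK', hKK', hK'L, hpos, hdist⟩ := hK.exists_cap hx hε
  have hL := hK.convexHull_insert x
  set L := convexHull ℝ (insert x K)
  by_contra! hcon
  have h1 := volume_mul_log_det_sub_log_det_le hK' hL
  have h2 := mul_nonneg hL.volume_real_pos.le
    (sub_nonneg.2 (log_det_covMatrix_le_of_forall hmono hK' hL hK'L))
  have hc : Continuous fun y => (d : ℝ) - mahalanobisSq K' y := by fun_prop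
  have h3 : ∫ y in L \ K', (mahalanobisSq K' y - d) = ∫ y in L, (mahalanobisSq K' y - d) := by
    rw [setIntegral_sdiff hK'.measurableSet (hL.integrableOn (by fun_prop)) hK'L,
      integral_mahalanobisSq_sub_self hK', sub_zero]
  have hlt : ∀ y ∈ L \ K', 0 < (d : ℝ) - mahalanobisSq K' y := fun y hy =>
    sub_pos.2 (hcon K' y hK' hKK' hK'L (hdist y hy))
  have hmeas : MeasurableSet (L \ K') := hL.measurableSet.diff hK'.measurableSet
  have h4 : 0 < ∫ y in L \ K', ((d : ℝ) - mahalanobisSq K' y) := by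
    rw [setIntegral_pos_iff_support_of_nonneg_ae
      ((ae_restrict_iff' hmeas).2 (ae_of_all _ fun y hy => (hlt y hy).le))
      ((hL.integrableOn hc).mono_set sdiff_subset)]
    rwa [inter_eq_self_of_subset_right
      (show L \ K' ⊆ Function.support _ from fun y hy => (hlt y hy).ne')]
  have h5 : ∫ y in L \ K', ((d : ℝ) - mahalanobisSq K' y) =
      -∫ y in L \ K', (mahalanobisSq K' y - d) := by
    rw [← integral_neg]
    simp
  linarith

lemma tendsto_setIntegral_of_subset_cthickening {F : Type*} [NormedAddCommGroup F]
    [NormedSpace ℝ F] (hK : IsConvexBody K) {S : ℕ → Set (EuclideanSpace ℝ (Fin d))}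
    {r : ℕ → ℝ} (hS : ∀ n, IsConvexBody (S n)) (hKS : ∀ n, K ⊆ S n)
    (hSr : ∀ n, S n ⊆ Metric.cthickening (r n) K) (hr : Tendsto r atTop (𝓝 0))
    {g : EuclideanSpace ℝ (Fin d) → F} (hg : Continuous g) :
    Tendsto (fun n => ∫ x in S n, g x) atTop (𝓝 (∫ x in K, g x)) := by
  have hT : IsCompact (Metric.cthickening 1 K) := hK.1.cthickening
  simp_rw [← integral_indicator (hS _).measurableSet, ← integral_indicator hK.measurableSet]
  refine tendsto_integral_filter_of_dominated_convergence
    ((Metric.cthickening 1 K).indicator fun x => ‖g x‖) ?_ ?_ ?_ ?_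
  · exact Eventually.of_forall fun n =>
      hg.aestronglyMeasurable.indicator (hS n).measurableSet
  · filter_upwards [hr.eventually (Iic_mem_nhds zero_lt_one)] with n hn
    refine ae_of_all _ fun x => ?_
    rw [norm_indicator_eq_indicator_norm]
    exact indicator_le_indicator_of_subset ((hSr n).trans (Metric.cthickening_mono hn K))
      (fun _ => norm_nonneg _) x
  · rw [integrable_indicator_iff hT.measurableSet]
    exact hg.norm.continuousOn.integrableOn_compact hT
  · refine ae_of_all _ fun x => ?_
    by_cases hx : x ∈ K
    · simp [indicator_of_mem hx, indicator_of_mem (hKS _ hx)]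
    · rw [indicator_of_notMem hx]
      refine tendsto_const_nhds.congr' ?_
      have hpos : 0 < Metric.infEDist x K :=
        pos_iff_ne_zero.2 fun h => hx ((Metric.mem_iff_infEDist_zero_of_closed hK.1.isClosed).2 h)
      have hr' : Tendsto (fun n => ENNReal.ofReal (r n)) atTop (𝓝 0) := by
        simpa using ENNReal.tendsto_ofReal hr
      filter_upwards [hr'.eventually (Iio_mem_nhds hpos)] with n hn
      rw [indicator_of_notMem fun h => not_le.2 hn (Metric.mem_cthickening_iff.1 (hSr n h))]

lemma tendsto_setAverage_of_subset_cthickening {F : Type*} [NormedAddCommGroup F]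
    [NormedSpace ℝ F] (hK : IsConvexBody K) {S : ℕ → Set (EuclideanSpace ℝ (Fin d))}
    {r : ℕ → ℝ} (hS : ∀ n, IsConvexBody (S n)) (hKS : ∀ n, K ⊆ S n)
    (hSr : ∀ n, S n ⊆ Metric.cthickening (r n) K) (hr : Tendsto r atTop (𝓝 0))
    {g : EuclideanSpace ℝ (Fin d) → F} (hg : Continuous g) :
    Tendsto (fun n => ⨍ x in S n, g x) atTop (𝓝 (⨍ x in K, g x)) := by
  simp_rw [setAverage_eq]
  have h1 := tendsto_setIntegral_of_subset_cthickening hK hS hKS hSr hr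
    (continuous_const (y := (1 : ℝ)))
  simp only [setIntegral_const, smul_eq_mul, mul_one] at h1
  exact (h1.inv₀ hK.volume_real_pos.ne').smul
    (tendsto_setIntegral_of_subset_cthickening hK hS hKS hSr hr hg)

lemma tendsto_mahalanobisSq_of_subset_cthickening
    (hK : IsConvexBody K) {S : ℕ → Set (EuclideanSpace ℝ (Fin d))}
    {r : ℕ → ℝ} (hS : ∀ n, IsConvexBody (S n)) (hKS : ∀ n, K ⊆ S n)
    (hSr : ∀ n, S n ⊆ Metric.cthickening (r n) K) (hr : Tendsto r atTop (𝓝 0))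
    {y : ℕ → EuclideanSpace ℝ (Fin d)} {x : EuclideanSpace ℝ (Fin d)}
    (hy : Tendsto y atTop (𝓝 x)) :
    Tendsto (fun n => mahalanobisSq (S n) (y n)) atTop (𝓝 (mahalanobisSq K x)) := by
  have hc : Tendsto (fun n => centroid (S n)) atTop (𝓝 (centroid K)) :=
    tendsto_setAverage_of_subset_cthickening hK hS hKS hSr hr continuous_id
  have hci : ∀ i, Tendsto (fun n => centroid (S n) i) atTop (𝓝 (centroid K i)) := fun i =>
    ((EuclideanSpace.proj i : EuclideanSpace ℝ (Fin d) →L[ℝ] ℝ).continuous.tendsto _).comp hc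
  have hA : Tendsto (fun n => covMatrix (S n)) atTop (𝓝 (covMatrix K)) := by
    refine tendsto_pi_nhds.2 fun i => tendsto_pi_nhds.2 fun j => ?_
    simp_rw [(hS _).covMatrix_apply, hK.covMatrix_apply]
    exact (tendsto_setAverage_of_subset_cthickening hK hS hKS hSr hr (by fun_prop)).sub
      ((hci i).mul (hci j))
  have hP : Tendsto (fun n => (covMatrix (S n))⁻¹) atTop (𝓝 (covMatrix K)⁻¹) := by
    simp_rw [Matrix.inv_def, Ring.inverse_eq_inv']
    refine Tendsto.smul (Tendsto.inv₀ ?_ (covMatrix_posDef hK).det_pos.ne') ?_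
    · exact (continuous_id.matrix_det.tendsto _).comp hA
    · exact (continuous_id.matrix_adjugate.tendsto _).comp hA
  have hPij : ∀ i j, Tendsto (fun n => (covMatrix (S n))⁻¹ i j) atTop
      (𝓝 ((covMatrix K)⁻¹ i j)) := fun i j =>
    tendsto_pi_nhds.1 (tendsto_pi_nhds.1 hP i) j
  have hz : ∀ i, Tendsto (fun n => (y n - centroid (S n)) i) atTop
      (𝓝 ((x - centroid K) i)) := fun i =>
    ((EuclideanSpace.proj i : EuclideanSpace ℝ (Fin d) →L[ℝ] ℝ).continuous.tendsto _).comp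
      (hy.sub hc)
  simp_rw [mahalanobisSq, quadForm_eq_sum]
  exact tendsto_finsetSum _ fun i _ => tendsto_finsetSum _ fun j _ =>
    (hPij i j).mul ((hz i).mul (hz j))

lemma le_mahalanobisSq_of_mem_frontier (hmono : ∀ K L : Set (EuclideanSpace ℝ (Fin d)),
      IsConvexBody K → IsConvexBody L → K ⊆ L → (covMatrix K).det ≤ (covMatrix L).det)
    (hK : IsConvexBody K) {x : EuclideanSpace ℝ (Fin d)} (hx : x ∈ frontier K) :
    (d : ℝ) ≤ mahalanobisSq K x := by
  have hxK : x ∈ K := hK.1.isClosed.frontier_subset hx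
  obtain ⟨u, hu, hux⟩ := mem_closure_iff_seq_limit.1 (frontier_eq_closure_inter_closure.subset hx).2
  choose S y hS hKS hSu hyu hle using fun n : ℕ => exists_le_mahalanobisSq hmono hK (hu n)
    (Nat.one_div_pos_of_nat (α := ℝ) (n := n))
  have hr : Tendsto (fun n => dist (u n) x) atTop (𝓝 0) := tendsto_iff_dist_tendsto_zero.1 hux
  refine ge_of_tendsto' (tendsto_mahalanobisSq_of_subset_cthickening hK hS hKS
    (r := fun n => dist (u n) x) (fun n => (hSu n).trans ?_) hr (y := y) ?_) hle
  · refine convexHull_min (insert_subset ?_ (Metric.self_subset_cthickening K))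
      (hK.2.1.cthickening _)
    exact Metric.mem_cthickening_of_dist_le _ _ _ _ hxK le_rfl
  · have h0 : Tendsto (fun n => dist (y n) (u n)) atTop (𝓝 0) :=
      squeeze_zero (fun _ => dist_nonneg) (fun n => (hyu n).le)
        tendsto_one_div_add_atTop_nhds_zero_nat
    rw [tendsto_iff_dist_tendsto_zero]
    refine squeeze_zero (fun _ => dist_nonneg) (fun n => dist_triangle (y n) (u n) x) ?_
    simpa using h0.add hr

lemma mahalanobisSq_of_isIsotropic (hK : IsIsotropic K) (x : EuclideanSpace ℝ (Fin d)) :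
    mahalanobisSq K x = ‖x‖ ^ 2 := by
  rw [mahalanobisSq, hK.1, hK.2, sub_zero, inv_one, quadForm, one_mulVec,
    EuclideanSpace.real_norm_sq_eq]
  simp [dotProduct, sq]

lemma IsConvexBody.centroid_mem (hK : IsConvexBody K) : centroid K ∈ K :=
  hK.2.1.set_average_mem hK.1.isClosed hK.volume_ne_zero hK.volume_ne_top
    (ae_restrict_mem hK.measurableSet) (hK.integrableOn continuous_id)

lemma closedBall_subset_of_det_covMatrix_monotone
    (hmono : ∀ K L : Set (EuclideanSpace ℝ (Fin d)),
      IsConvexBody K → IsConvexBody L → K ⊆ L → (covMatrix K).det ≤ (covMatrix L).det)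
    (hK : IsConvexBody K) (hiso : IsIsotropic K) :
    Metric.closedBall 0 √d ⊆ K := by
  have h0 : (0 : EuclideanSpace ℝ (Fin d)) ∈ K := hiso.1 ▸ hK.centroid_mem
  rcases Nat.eq_zero_or_pos d with rfl | hd
  · intro x _
    rwa [Subsingleton.elim x 0]
  have hd' : √(d : ℝ) ≠ 0 := by positivity
  rw [← closure_ball _ hd']
  refine hK.1.isClosed.closure_subset_iff.2 ?_
  have hmem : Metric.ball 0 √d ∩ frontier K = ∅ := by
    refine eq_empty_of_forall_notMem fun x ⟨hx, hxf⟩ => ?_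
    have h := le_mahalanobisSq_of_mem_frontier hmono hK hxf
    rw [mahalanobisSq_of_isIsotropic hiso] at h
    rw [mem_ball_zero_iff] at hx
    exact absurd (Real.sqrt_le_left (norm_nonneg x) |>.2 h) (not_le.2 hx)
  have hmem' : ∀ x ∈ Metric.ball 0 √d ∩ K, x ∈ interior K := fun x hx => by
    by_contra h
    exact (hmem.subset ⟨hx.1, subset_closure hx.2, h⟩).elim
  have h0b : (0 : EuclideanSpace ℝ (Fin d)) ∈ Metric.ball 0 √d :=
    Metric.mem_ball_self (by positivity)
  refine ((convex_ball _ _).isPreconnected.subset_of_closure_inter_subset isOpen_interior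
    ⟨0, h0b, hmem' 0 ⟨h0b, h0⟩⟩ fun x hx => hmem' x ⟨hx.2, ?_⟩).trans interior_subset
  exact hK.1.isClosed.closure_interior_subset hx.1

end Monotone

section AffineImage

variable {d : ℕ} {K L : Set (EuclideanSpace ℝ (Fin d))}

lemma mem_interior_image_affine
    (e : EuclideanSpace ℝ (Fin d) ≃L[ℝ] EuclideanSpace ℝ (Fin d)) (b : EuclideanSpace ℝ (Fin d))
    {x : EuclideanSpace ℝ (Fin d)} (hx : x ∈ interior K) :
    e x + b ∈ interior ((fun y => e y + b) '' K) := by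
  have h := (e.toHomeomorph.trans (Homeomorph.addRight b)).image_interior K
  have h' : e x + b ∈ (e.toHomeomorph.trans (Homeomorph.addRight b)) '' interior K := ⟨x, hx, rfl⟩
  rw [h] at h'
  exact h'

lemma IsConvexBody.image_affine (hK : IsConvexBody K)
    (e : EuclideanSpace ℝ (Fin d) ≃L[ℝ] EuclideanSpace ℝ (Fin d))
    (b : EuclideanSpace ℝ (Fin d)) : IsConvexBody ((fun y => e y + b) '' K) := by
  refine ⟨hK.1.image (by fun_prop), ?_, ?_⟩
  · have h := (hK.2.1.is_linear_image e.toLinearMap.isLinear).translate b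
    have he : (fun y => e y + b) = (fun x => b + x) ∘ e.toLinearMap := by
      ext1 y
      exact add_comm _ _
    rw [he, image_comp]
    exact h
  · obtain ⟨x, hx⟩ := hK.2.2
    exact ⟨_, mem_interior_image_affine e b hx⟩

lemma setIntegral_image_affine (hK : IsConvexBody K) {F : Type*} [NormedAddCommGroup F]
    [NormedSpace ℝ F] (e : EuclideanSpace ℝ (Fin d) ≃L[ℝ] EuclideanSpace ℝ (Fin d))
    (b : EuclideanSpace ℝ (Fin d)) (g : EuclideanSpace ℝ (Fin d) → F) :
    ∫ x in (fun y => e y + b) '' K, g x =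
      |(e : EuclideanSpace ℝ (Fin d) →L[ℝ] EuclideanSpace ℝ (Fin d)).det| •
        ∫ y in K, g (e y + b) := by
  rw [integral_image_eq_integral_abs_det_fderiv_smul volume hK.measurableSet
    (f' := fun _ => (e : EuclideanSpace ℝ (Fin d) →L[ℝ] EuclideanSpace ℝ (Fin d)))
    (fun x _ => (e.hasFDerivAt.add_const b).hasFDerivWithinAt)
    (fun x _ y _ h => e.injective (add_right_cancel h)), integral_smul]

lemma setAverage_image_affine (hK : IsConvexBody K) {F : Type*} [NormedAddCommGroup F]
    [NormedSpace ℝ F] (e : EuclideanSpace ℝ (Fin d) ≃L[ℝ] EuclideanSpace ℝ (Fin d))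
    (b : EuclideanSpace ℝ (Fin d)) (g : EuclideanSpace ℝ (Fin d) → F) :
    ⨍ x in (fun y => e y + b) '' K, g x = ⨍ y in K, g (e y + b) := by
  have hdet : |(e : EuclideanSpace ℝ (Fin d) →L[ℝ] EuclideanSpace ℝ (Fin d)).det| ≠ 0 :=
    abs_ne_zero.2 (LinearEquiv.isUnit_det' e.toLinearEquiv).ne_zero
  have h1 := setIntegral_image_affine hK e b (fun _ => (1 : ℝ))
  simp only [setIntegral_const, smul_eq_mul, mul_one] at h1
  rw [setAverage_eq, setAverage_eq, h1, setIntegral_image_affine hK e b g, smul_smul]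
  congr 1
  field_simp

lemma centroid_image_affine (hK : IsConvexBody K)
    (e : EuclideanSpace ℝ (Fin d) ≃L[ℝ] EuclideanSpace ℝ (Fin d))
    (b : EuclideanSpace ℝ (Fin d)) :
    centroid ((fun y => e y + b) '' K) = e (centroid K) + b := by
  have := hK.isProbabilityMeasure
  rw [centroid, setAverage_image_affine hK, centroid, setAverage_eq', setAverage_eq',
    integral_add (hK.integrable_uniform (by fun_prop)) (integrable_const _)]
  congr 1
  · exact (e : EuclideanSpace ℝ (Fin d) →L[ℝ] EuclideanSpace ℝ (Fin d)).integral_comp_comm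
      (hK.integrable_uniform continuous_id)
  · simp

lemma covMatrix_image_affine (hK : IsConvexBody K)
    {e : EuclideanSpace ℝ (Fin d) ≃L[ℝ] EuclideanSpace ℝ (Fin d)}
    {C : Matrix (Fin d) (Fin d) ℝ} (he : ∀ y, (e y).ofLp = C *ᵥ y.ofLp)
    (b : EuclideanSpace ℝ (Fin d)) :
    covMatrix ((fun y => e y + b) '' K) = C * covMatrix K * Cᵀ := by
  ext i j
  rw [covMatrix, of_apply, setAverage_image_affine hK, centroid_image_affine hK]
  have h : ∀ y : EuclideanSpace ℝ (Fin d),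
      ((e y + b) i - (e (centroid K) + b) i) * ((e y + b) j - (e (centroid K) + b) j) =
        quadForm (vecMulVec (C i) (C j)) (y - centroid K) := by
    intro y
    have hk : ∀ k, (e y + b) k - (e (centroid K) + b) k = C k ⬝ᵥ (y - centroid K).ofLp := by
      intro k
      have : (e (y - centroid K)) k = C k ⬝ᵥ (y - centroid K).ofLp := by
        rw [he]; rfl
      rw [← this]
      simp
    rw [hk, hk, quadForm, vecMulVec_mulVec]
    simp [dotProduct_comm (C i)]
  simp_rw [h]
  rw [setAverage_quadForm hK, sub_self]
  have h0 : quadForm (vecMulVec (C i) (C j)) 0 = 0 := by simp [quadForm]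
  have hT : (covMatrix K)ᵀ = covMatrix K := by
    simpa using (covMatrix_posDef hK).isHermitian.eq
  rw [h0, add_zero, vecMulVec_mul, trace_vecMulVec, ← mulVec_transpose, hT, Matrix.mul_assoc]
  rfl

/-- A positive definite form can be diagonalized by a linear change of coordinates. -/
lemma exists_whitening {A : Matrix (Fin d) (Fin d) ℝ} (hA : A.PosDef) :
    ∃ (C : Matrix (Fin d) (Fin d) ℝ)
      (e : EuclideanSpace ℝ (Fin d) ≃L[ℝ] EuclideanSpace ℝ (Fin d)),
      (∀ y, (e y).ofLp = C *ᵥ y.ofLp) ∧ C * A * Cᵀ = 1 ∧ ∀ z, quadForm A⁻¹ z = ‖e z‖ ^ 2 := by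
  open scoped MatrixOrder in
  obtain ⟨C, hCu, hC⟩ := CStarAlgebra.isStrictlyPositive_iff_eq_star_mul_self.mp
    hA.inv.isStrictlyPositive
  rw [star_eq_conjTranspose, conjTranspose_eq_transpose_of_trivial] at hC
  have hdet := (Matrix.isUnit_iff_isUnit_det _).1 hCu
  let e := ((WithLp.linearEquiv 2 ℝ (Fin d → ℝ)).trans (Matrix.toLin'OfInv
    (Matrix.nonsing_inv_mul C hdet) (Matrix.mul_nonsing_inv C hdet))).trans
      (WithLp.linearEquiv 2 ℝ (Fin d → ℝ)).symm |>.toContinuousLinearEquiv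
  have he : ∀ y, (e y).ofLp = C *ᵥ y.ofLp := fun y => by simp [e, Matrix.toLin'OfInv]
  refine ⟨C, e, he, ?_, fun z => ?_⟩
  · have h1 : Cᵀ * (C * A) = 1 := by
      rw [← Matrix.mul_assoc, ← hC,
        Matrix.nonsing_inv_mul _ ((Matrix.isUnit_iff_isUnit_det _).1 hA.isUnit)]
    exact mul_eq_one_comm.1 h1
  · rw [quadForm, hC, EuclideanSpace.real_norm_sq_eq, ← mulVec_mulVec, dotProduct_mulVec,
      vecMul_transpose, ← he]
    simp [dotProduct, sq]

lemma mem_of_mahalanobisSq_le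
    (hball : ∀ K : Set (EuclideanSpace ℝ (Fin d)), IsConvexBody K → IsIsotropic K →
      Metric.closedBall (0 : EuclideanSpace ℝ (Fin d)) √d ⊆ K)
    (hK : IsConvexBody K) {y : EuclideanSpace ℝ (Fin d)} (hy : mahalanobisSq K y ≤ d) :
    y ∈ K := by
  obtain ⟨C, e, he, hC, hq⟩ := exists_whitening (covMatrix_posDef hK)
  have h := hball _ (hK.image_affine e (-e (centroid K)))
    ⟨by rw [centroid_image_affine hK, add_neg_cancel], by rw [covMatrix_image_affine hK he, hC]⟩
  have hmem : e (y - centroid K) ∈ Metric.closedBall (0 : EuclideanSpace ℝ (Fin d)) √d := by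
    rw [mem_closedBall_zero_iff]
    refine Real.le_sqrt_of_sq_le ?_
    rwa [← hq]
  obtain ⟨x, hx, hxy⟩ := h hmem
  rw [map_sub, sub_eq_add_neg] at hxy
  exact e.injective (add_right_cancel hxy) ▸ hx

lemma sub_mahalanobisSq_le
    (hball : ∀ K : Set (EuclideanSpace ℝ (Fin d)), IsConvexBody K → IsIsotropic K →
      Metric.closedBall (0 : EuclideanSpace ℝ (Fin d)) √d ⊆ K)
    (hK : IsConvexBody K) {y : EuclideanSpace ℝ (Fin d)} {t D : ℝ} (ht : 0 ≤ t) (hD : 0 ≤ D)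
    (hy : (1 + t) • y ∉ K) (hyD : quadForm (covMatrix K)⁻¹ y ≤ D ^ 2) :
    d - mahalanobisSq K y ≤ 2 * √d * (t * D) := by
  obtain ⟨C, e, he, hC, hq⟩ := exists_whitening (covMatrix_posDef hK)
  have h1 : (d : ℝ) < ‖e ((1 + t) • y - centroid K)‖ ^ 2 := by
    rw [← hq]
    exact not_le.1 fun h => hy (mem_of_mahalanobisSq_le hball hK h)
  have h2 : √d ≤ ‖e ((1 + t) • y - centroid K)‖ := Real.sqrt_le_left (norm_nonneg _) |>.2 h1.le
  have h3 : ‖e ((1 + t) • y - centroid K)‖ ≤ ‖e (y - centroid K)‖ + t * ‖e y‖ := by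
    have : (1 + t) • y - centroid K = (y - centroid K) + t • y := by module
    rw [this, map_add, map_smul]
    refine (norm_add_le _ _).trans_eq ?_
    rw [norm_smul, Real.norm_of_nonneg ht]
  have h4 : ‖e y‖ ≤ D := by
    rw [hq] at hyD
    exact le_of_sq_le_sq hyD hD
  rw [mahalanobisSq, hq]
  have h5 := Real.sq_sqrt (Nat.cast_nonneg (α := ℝ) d)
  have h6 : √d - ‖e (y - centroid K)‖ ≤ t * D := by nlinarith
  have h7 := Real.sqrt_nonneg (d : ℝ)
  nlinarith [sq_nonneg (√d - ‖e (y - centroid K)‖), mul_le_mul_of_nonneg_left h6 h7]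

lemma mul_quadForm_inv_le {A B : Matrix (Fin d) (Fin d) ℝ} (hA : A.PosDef) (hB : B.PosDef)
    {c : ℝ} (hc : 0 ≤ c) (h : ∀ v, c * (v ⬝ᵥ A *ᵥ v) ≤ v ⬝ᵥ B *ᵥ v)
    (z : EuclideanSpace ℝ (Fin d)) : c * quadForm B⁻¹ z ≤ quadForm A⁻¹ z := by
  set w := B⁻¹ *ᵥ z.ofLp with hw
  set u := A⁻¹ *ᵥ z.ofLp with hu
  have hBw : B *ᵥ w = z.ofLp := by
    rw [hw, mulVec_mulVec, Matrix.mul_nonsing_inv _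
      ((Matrix.isUnit_iff_isUnit_det _).1 hB.isUnit), one_mulVec]
  have hAu : A *ᵥ u = z.ofLp := by
    rw [hu, mulVec_mulVec, Matrix.mul_nonsing_inv _
      ((Matrix.isUnit_iff_isUnit_det _).1 hA.isUnit), one_mulVec]
  have hsym : u ⬝ᵥ A *ᵥ w = z.ofLp ⬝ᵥ w := by
    have hT : Aᵀ = A := by simpa using hA.isHermitian.eq
    rw [dotProduct_mulVec, ← mulVec_transpose, hT, hAu]
  have h0 : 0 ≤ (c • w - u) ⬝ᵥ A *ᵥ (c • w - u) := by
    simpa using hA.posSemidef.dotProduct_mulVec_nonneg (c • w - u)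
  simp only [mulVec_sub, mulVec_smul, dotProduct_sub, sub_dotProduct, smul_dotProduct,
    dotProduct_smul, hAu, hsym, smul_eq_mul] at h0
  have h1 := mul_le_mul_of_nonneg_left (h w) hc
  rw [hBw] at h1
  rw [quadForm, quadForm, ← hw, ← hu]
  rw [dotProduct_comm w z.ofLp, dotProduct_comm u z.ofLp] at h0
  rw [dotProduct_comm w z.ofLp] at h1
  linarith

lemma volume_mul_quadForm_inv_covMatrix_le (hK : IsConvexBody K) (hL : IsConvexBody L)
    (hKL : K ⊆ L) (z : EuclideanSpace ℝ (Fin d)) :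
    volume.real K * quadForm (covMatrix L)⁻¹ z ≤
      volume.real L * quadForm (covMatrix K)⁻¹ z := by
  have hv := hL.volume_real_pos
  have h := mul_quadForm_inv_le (covMatrix_posDef hK) (covMatrix_posDef hL)
    (c := volume.real K / volume.real L) (by positivity) ?_ z
  · rw [div_mul_eq_mul_div, div_le_iff₀ hv] at h
    linarith
  intro v
  rw [div_mul_eq_mul_div, div_le_iff₀ hv, mul_comm _ (volume.real L)]
  have hc : Continuous fun x : EuclideanSpace ℝ (Fin d) => (v ⬝ᵥ (x - centroid L).ofLp) ^ 2 := by
    simp only [dotProduct]; fun_prop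
  have h1 := setAverage_dotProduct_sq hK v (centroid L)
  have h2 := setAverage_dotProduct_sq hL v (centroid L)
  simp only [sub_self, WithLp.ofLp_zero, dotProduct_zero, ne_eq, OfNat.ofNat_ne_zero,
    not_false_eq_true, zero_pow, add_zero] at h2
  rw [setAverage_eq, smul_eq_mul, inv_mul_eq_iff_eq_mul₀ hK.volume_real_pos.ne'] at h1
  rw [setAverage_eq, smul_eq_mul, inv_mul_eq_iff_eq_mul₀ hv.ne'] at h2
  rw [← h2]
  refine le_trans ?_ (setIntegral_mono_set (hL.integrableOn hc) (ae_of_all _ fun _ => sq_nonneg _)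
    hKL.eventuallyLE)
  rw [h1]
  exact mul_le_mul_of_nonneg_left (le_add_of_nonneg_right (sq_nonneg _)) hK.volume_real_pos.le

end AffineImage

section Path

variable {d : ℕ} {K L : Set (EuclideanSpace ℝ (Fin d))}

lemma le_of_sub_le_mul_mul_sub {F V : ℝ → ℝ} {a b C : ℝ} (hab : a ≤ b)
    (h : ∀ s t, a ≤ s → s ≤ t → F s - F t ≤ C * (t - s) * (V t - V s)) : F a ≤ F b := by
  have key : ∀ n : ℕ, F a - F b ≤ C * (V b - V a) * (b - a) * (1 / ((n : ℝ) + 1)) := by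
    intro n
    set η := (b - a) / ((n : ℝ) + 1) with hη
    have hη0 : 0 ≤ η := div_nonneg (sub_nonneg.2 hab) (by positivity)
    have ind : ∀ i : ℕ, F a - F (a + i * η) ≤ C * η * (V (a + i * η) - V a) := by
      intro i
      induction i with
      | zero => simp
      | succ i ih =>
        have := h (a + i * η) (a + (i + 1 : ℕ) * η)
          (le_add_of_nonneg_right (mul_nonneg (Nat.cast_nonneg i) hη0))
          (by push_cast; linarith)
        have e : a + (i + 1 : ℕ) * η - (a + i * η) = η := by push_cast; ring
        rw [e] at this
        linarith
    have hn := ind (n + 1)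
    have e : a + (n + 1 : ℕ) * η = b := by
      rw [hη]; push_cast; field_simp; ring
    rw [e] at hn
    refine hn.trans_eq ?_
    rw [hη]; ring
  have hlim := (tendsto_one_div_add_atTop_nhds_zero_nat (𝕜 := ℝ)).const_mul
    (C * (V b - V a) * (b - a))
  rw [mul_zero] at hlim
  exact sub_nonpos.1 (ge_of_tendsto' hlim key)

lemma isConvexBody_inter_preimage_smul (hK : IsConvexBody K) (hL : IsConvexBody L)
    (hKL : K ⊆ L) (h0 : (0 : EuclideanSpace ℝ (Fin d)) ∈ K) {s : ℝ} (hs : 1 ≤ s) :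
    IsConvexBody (L ∩ (fun y => s⁻¹ • y) ⁻¹' K) ∧ K ⊆ L ∩ (fun y => s⁻¹ • y) ⁻¹' K := by
  have hsub : K ⊆ L ∩ (fun y => s⁻¹ • y) ⁻¹' K := fun y hy =>
    ⟨hKL hy, hK.2.1.smul_mem_of_zero_mem h0 hy ⟨by positivity, inv_le_one_of_one_le₀ hs⟩⟩
  exact ⟨⟨hL.1.inter_right (hK.1.isClosed.preimage (by fun_prop)),
    hL.2.1.inter (hK.2.1.smul_preimage _), hK.2.2.mono (interior_mono hsub)⟩, hsub⟩

lemma log_det_covMatrix_step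
    (hball : ∀ K : Set (EuclideanSpace ℝ (Fin d)), IsConvexBody K → IsIsotropic K →
      Metric.closedBall (0 : EuclideanSpace ℝ (Fin d)) √d ⊆ K)
    (hK : IsConvexBody K) (hL : IsConvexBody L) (hKL : K ⊆ L)
    (h0 : (0 : EuclideanSpace ℝ (Fin d)) ∈ K) :
    ∃ C : ℝ, ∀ s t : ℝ, 1 ≤ s → s ≤ t →
      Real.log (covMatrix (L ∩ (fun y => s⁻¹ • y) ⁻¹' K)).det -
        Real.log (covMatrix (L ∩ (fun y => t⁻¹ • y) ⁻¹' K)).det ≤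
      C * (t - s) * (volume.real (L ∩ (fun y => t⁻¹ • y) ⁻¹' K) -
        volume.real (L ∩ (fun y => s⁻¹ • y) ⁻¹' K)) := by
  obtain ⟨B, hB⟩ := (hL.1.image (continuous_quadForm (covMatrix K)⁻¹)).bddAbove
  have hvK := hK.volume_real_pos
  set D := √(volume.real L * |B| / volume.real K) with hD
  have hD0 : 0 ≤ D := Real.sqrt_nonneg _
  have hDsq : D ^ 2 = volume.real L * |B| / volume.real K := Real.sq_sqrt (by positivity)
  refine ⟨2 * √d * D / volume.real K, fun s t hs hst => ?_⟩
  obtain ⟨hN, hKN⟩ := isConvexBody_inter_preimage_smul hK hL hKL h0 hs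
  obtain ⟨hM, hKM⟩ := isConvexBody_inter_preimage_smul hK hL hKL h0 (hs.trans hst)
  have hs0 : 0 < s := by linarith
  have ht0 : 0 < t := by linarith
  have hNM : L ∩ (fun y => s⁻¹ • y) ⁻¹' K ⊆ L ∩ (fun y => t⁻¹ • y) ⁻¹' K := by
    rintro y ⟨hyL, hy⟩
    refine ⟨hyL, ?_⟩
    have := hK.2.1.smul_mem_of_zero_mem h0 hy (t := s / t)
      ⟨by positivity, (div_le_one ht0).2 hst⟩
    rw [smul_smul] at this
    have e : s / t * s⁻¹ = t⁻¹ := by field_simp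
    rwa [e] at this
  have hdiff : ∀ y ∈ (L ∩ (fun y => t⁻¹ • y) ⁻¹' K) \ (L ∩ (fun y => s⁻¹ • y) ⁻¹' K),
      (1 + (t - s) / s) • y ∉ L ∩ (fun y => t⁻¹ • y) ⁻¹' K := by
    rintro y ⟨hyM, hyN⟩ hmem
    refine hyN ⟨hyM.1, ?_⟩
    have := hmem.2
    simp only [mem_preimage, smul_smul] at this ⊢
    have e : t⁻¹ * (1 + (t - s) / s) = s⁻¹ := by field_simp; ring
    rwa [e] at this
  set N := L ∩ (fun y => s⁻¹ • y) ⁻¹' K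
  set M := L ∩ (fun y => t⁻¹ • y) ⁻¹' K
  have hbound : ∀ y ∈ M \ N, d - mahalanobisSq M y ≤ 2 * √d * ((t - s) * D) := by
    intro y hy
    have hq : quadForm (covMatrix M)⁻¹ y ≤ D ^ 2 := by
      rw [hDsq, le_div_iff₀ hvK, mul_comm]
      refine (volume_mul_quadForm_inv_covMatrix_le hK hM hKM y).trans ?_
      have hqK : quadForm (covMatrix K)⁻¹ y ≤ |B| :=
        (hB (mem_image_of_mem _ hy.1.1)).trans (le_abs_self B)
      have hML : volume.real M ≤ volume.real L := measureReal_mono inter_subset_left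
        hL.volume_ne_top
      have := quadForm_nonneg (covMatrix_posDef hK).inv.posSemidef y
      gcongr
    have hts : 0 ≤ t - s := sub_nonneg.2 hst
    refine (sub_mahalanobisSq_le hball hM (t := (t - s) / s) (by positivity) hD0
      (hdiff y hy) hq).trans ?_
    have : (t - s) / s ≤ t - s := div_le_self hts hs
    gcongr
  have hKL' := volume_mul_log_det_sub_log_det_le hM hN
  have hc : Continuous fun y => (d : ℝ) - mahalanobisSq M y := by fun_prop
  have hswap : ∫ x in N, (mahalanobisSq M x - d) = ∫ x in M \ N, (d - mahalanobisSq M x) := by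
    have h1 := setIntegral_sdiff (μ := volume) hN.measurableSet
      (hM.integrableOn (g := fun x => mahalanobisSq M x - d) (by fun_prop)) hNM
    rw [integral_mahalanobisSq_sub_self hM] at h1
    have h2 : ∫ x in M \ N, (d - mahalanobisSq M x) =
        -∫ x in M \ N, (mahalanobisSq M x - d) := by
      rw [← integral_neg]
      simp
    linarith
  have hmeas : MeasurableSet (M \ N) := hM.measurableSet.diff hN.measurableSet
  have hle : ∫ x in M \ N, (d - mahalanobisSq M x) ≤
      ∫ _ in M \ N, (2 * √d * ((t - s) * D)) :=
    setIntegral_mono_on ((hM.integrableOn hc).mono_set sdiff_subset)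
      ((hM.integrableOn continuous_const).mono_set sdiff_subset) hmeas hbound
  rw [setIntegral_const, smul_eq_mul, measureReal_sdiff hNM hN.measurableSet
    (h₁ := hM.volume_ne_top)] at hle
  have hvN := hN.volume_real_pos
  have hvKN : volume.real K ≤ volume.real N := measureReal_mono hKN hN.volume_ne_top
  have hvNM : volume.real N ≤ volume.real M := measureReal_mono hNM hM.volume_ne_top
  set R := (volume.real M - volume.real N) * (2 * √d * ((t - s) * D)) with hR
  have hR0 : 0 ≤ R := mul_nonneg (sub_nonneg.2 hvNM)
    (mul_nonneg (by positivity) (mul_nonneg (sub_nonneg.2 hst) hD0))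
  have e : 2 * √d * D / volume.real K * (t - s) * (volume.real M - volume.real N) =
      R / volume.real K := by rw [hR]; ring
  rw [e]
  calc _ ≤ R / volume.real N := by
        rw [le_div_iff₀' hvN]; linarith
    _ ≤ R / volume.real K := by gcongr

lemma log_det_covMatrix_le_of_zero_mem_interior
    (hball : ∀ K : Set (EuclideanSpace ℝ (Fin d)), IsConvexBody K → IsIsotropic K →
      Metric.closedBall (0 : EuclideanSpace ℝ (Fin d)) √d ⊆ K)
    (hK : IsConvexBody K) (hL : IsConvexBody L) (hKL : K ⊆ L)
    (h0 : (0 : EuclideanSpace ℝ (Fin d)) ∈ interior K) :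
    Real.log (covMatrix K).det ≤ Real.log (covMatrix L).det := by
  obtain ⟨C, hC⟩ := log_det_covMatrix_step hball hK hL hKL (interior_subset h0)
  obtain ⟨r, hr, hrK⟩ := Metric.mem_nhds_iff.1 (mem_interior_iff_mem_nhds.1 h0)
  obtain ⟨R, hR⟩ := hL.1.isBounded.subset_closedBall 0
  have hρ : 1 ≤ 1 + |R| / r := le_add_of_nonneg_right (by positivity)
  have h := le_of_sub_le_mul_mul_sub (F := fun s =>
      Real.log (covMatrix (L ∩ (fun y => s⁻¹ • y) ⁻¹' K)).det)
    (V := fun s => volume.real (L ∩ (fun y => s⁻¹ • y) ⁻¹' K)) hρ hC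
  have h1 : L ∩ (fun y => (1 : ℝ)⁻¹ • y) ⁻¹' K = K := by
    simpa using hKL
  have h2 : L ∩ (fun y => (1 + |R| / r)⁻¹ • y) ⁻¹' K = L := by
    refine inter_eq_left.2 fun y hy => hrK ?_
    have hyR := mem_closedBall_zero_iff.1 (hR hy)
    rw [mem_ball_zero_iff, norm_smul, Real.norm_of_nonneg (by positivity),
      inv_mul_lt_iff₀ (by positivity), add_mul, div_mul_cancel₀ _ hr.ne']
    linarith [le_abs_self R]
  simpa only [h1, h2] using h

lemma det_covMatrix_monotone_of_closedBall_subset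
    (hball : ∀ K : Set (EuclideanSpace ℝ (Fin d)), IsConvexBody K → IsIsotropic K →
      Metric.closedBall (0 : EuclideanSpace ℝ (Fin d)) √d ⊆ K)
    (hK : IsConvexBody K) (hL : IsConvexBody L) (hKL : K ⊆ L) :
    (covMatrix K).det ≤ (covMatrix L).det := by
  obtain ⟨x, hx⟩ := hK.2.2
  let e := ContinuousLinearEquiv.refl ℝ (EuclideanSpace ℝ (Fin d))
  have hcov : ∀ {S : Set (EuclideanSpace ℝ (Fin d))}, IsConvexBody S →
      covMatrix ((fun y => e y + -x) '' S) = covMatrix S := fun hS => by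
    rw [covMatrix_image_affine hS (C := 1) (fun y => (one_mulVec _).symm)]
    simp
  have h0 : (0 : EuclideanSpace ℝ (Fin d)) ∈ interior ((fun y => e y + -x) '' K) := by
    simpa [e] using mem_interior_image_affine e (-x) hx
  have h := log_det_covMatrix_le_of_zero_mem_interior hball (hK.image_affine e (-x))
    (hL.image_affine e (-x)) (image_mono hKL) h0
  rw [hcov hK, hcov hL] at h
  exact (Real.log_le_log_iff (covMatrix_posDef hK).det_pos (covMatrix_posDef hL).det_pos).1 h

end Path

/-- Monotonicity of `det A(·)` under inclusion in dimension `d` holds iff every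
isotropic convex body in `ℝ^d` contains the ball of radius `√d` centered at the
origin. -/
theorem det_covMatrix_monotone_iff_isotropic_contains_ball (d : ℕ) :
    (∀ K L : Set (EuclideanSpace ℝ (Fin d)),
        IsConvexBody K → IsConvexBody L → K ⊆ L →
        (covMatrix K).det ≤ (covMatrix L).det) ↔
    (∀ K : Set (EuclideanSpace ℝ (Fin d)),
        IsConvexBody K → IsIsotropic K →
        Metric.closedBall (0 : EuclideanSpace ℝ (Fin d)) (Real.sqrt d) ⊆ K) := by
  exact ⟨fun hmono _ hK hiso => closedBall_subset_of_det_covMatrix_monotone hmono hK hiso,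
    fun hball _ _ hK hL hKL => det_covMatrix_monotone_of_closedBall_subset hball hK hL hKL⟩
end

section
/- For every integer d ≥ 1, √(d/(2π)) ≤ κ_{d−1}/κ_d ≤ √((d+1)/(2π)), where κ_n = π^{n/2}/Γ(1 + n/2) is the volume of the n-dimensional Euclidean unit ball. -/
/-- `κ_n`: the volume of the `n`-dimensional Euclidean unit ball,
`κ_n = π^{n/2} / Γ(1 + n/2)`. -/
noncomputable def unitBallVol (n : ℕ) : ℝ :=
  Real.pi ^ ((n : ℝ) / 2) / Real.Gamma (1 + (n : ℝ) / 2)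

/-- Midpoint log-convexity of the Gamma function. -/
theorem Real.Gamma_add_half_sq_le {x : ℝ} (hx : 0 < x) :
    Real.Gamma (x + 1 / 2) ^ 2 ≤ x * Real.Gamma x ^ 2 := by
  have h := Real.Gamma_mul_add_mul_le_rpow_Gamma_mul_rpow_Gamma hx (add_pos hx one_pos)
    one_half_pos one_half_pos (add_halves (1 : ℝ))
  have hG := Real.Gamma_pos_of_pos hx
  have hG' := Real.Gamma_pos_of_pos (add_pos hx one_pos)
  rw [← Real.sqrt_eq_rpow, ← Real.sqrt_eq_rpow, ← Real.sqrt_mul hG.le,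
    show 1 / 2 * x + 1 / 2 * (x + 1) = x + 1 / 2 by ring,
    Real.le_sqrt (Real.Gamma_pos_of_pos (by linarith)).le (mul_pos hG hG').le,
    Real.Gamma_add_one hx.ne'] at h
  linarith

theorem unitBallVol_div_unitBallVol_succ (n : ℕ) :
    unitBallVol n / unitBallVol (n + 1) =
      Real.Gamma ((n : ℝ) / 2 + 1 + 1 / 2) / (√Real.pi * Real.Gamma ((n : ℝ) / 2 + 1)) := by
  have hG := Real.Gamma_pos_of_pos (show 0 < (n : ℝ) / 2 + 1 by positivity)
  have hG' := Real.Gamma_pos_of_pos (show 0 < (n : ℝ) / 2 + 1 + 1 / 2 by positivity)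
  have hpi := Real.rpow_pos_of_pos Real.pi_pos ((n : ℝ) / 2)
  have hs := Real.sqrt_pos.2 Real.pi_pos
  unfold unitBallVol
  rw [show ((n + 1 : ℕ) : ℝ) / 2 = n / 2 + 1 / 2 by push_cast; ring,
    Real.rpow_add Real.pi_pos, ← Real.sqrt_eq_rpow,
    show 1 + ((n : ℝ) / 2 + 1 / 2) = n / 2 + 1 + 1 / 2 by ring, add_comm 1 ((n : ℝ) / 2)]
  field_simp

/-- For every `d ≥ 1`, `√(d/(2π)) ≤ κ_{d−1}/κ_d ≤ √((d+1)/(2π))`. -/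
theorem unitBallVol_ratio_bounds (d : ℕ) (hd : 1 ≤ d) :
    Real.sqrt (d / (2 * Real.pi)) ≤ unitBallVol (d - 1) / unitBallVol d ∧
    unitBallVol (d - 1) / unitBallVol d ≤ Real.sqrt ((d + 1) / (2 * Real.pi)) := by
  obtain ⟨n, rfl⟩ := Nat.exists_eq_add_of_le' hd
  rw [Nat.add_sub_cancel, unitBallVol_div_unitBallVol_succ]
  push_cast
  have hx : 0 < (n : ℝ) / 2 + 1 / 2 := by positivity
  have hG := Real.Gamma_pos_of_pos (show 0 < (n : ℝ) / 2 + 1 by positivity)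
  have hG' := Real.Gamma_pos_of_pos (show 0 < (n : ℝ) / 2 + 1 + 1 / 2 by positivity)
  have hpi := Real.pi_pos
  have upper := Real.Gamma_add_half_sq_le (show 0 < (n : ℝ) / 2 + 1 by positivity)
  have lower := Real.Gamma_add_half_sq_le hx
  have hrec := Real.Gamma_add_one hx.ne'
  rw [show (n : ℝ) / 2 + 1 / 2 + 1 = n / 2 + 1 + 1 / 2 by ring] at hrec
  rw [show (n : ℝ) / 2 + 1 / 2 + 1 / 2 = n / 2 + 1 by ring] at lower
  constructor
  · refine Real.sqrt_le_iff.2 ⟨by positivity, ?_⟩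
    rw [div_pow, mul_pow, Real.sq_sqrt hpi.le, div_le_div_iff₀ (by positivity) (by positivity),
      hrec]
    have := mul_le_mul_of_nonneg_left lower (mul_pos hx hpi).le
    linarith
  · refine Real.le_sqrt_of_sq_le ?_
    rw [div_pow, mul_pow, Real.sq_sqrt hpi.le, div_le_div_iff₀ (by positivity) (by positivity)]
    have := mul_le_mul_of_nonneg_left upper hpi.le
    linarith
end

section
/- For every real α ∈ (0,1) and every real x ≥ 1, (x + α − 1)^α ≤ Γ(x+α)/Γ(x) ≤ x^α, where Γ is the Gamma function. -/
/-- Wendel's upper bound for a shifted value of `Γ`, from log-convexity. -/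
theorem Real.Gamma_add_le_rpow_mul_Gamma {a x : ℝ} (hx : 0 < x) (ha0 : 0 < a) (ha1 : a < 1) :
    Real.Gamma (x + a) ≤ x ^ a * Real.Gamma x := by
  have hΓ := Real.Gamma_pos_of_pos hx
  calc Real.Gamma (x + a) = Real.Gamma ((1 - a) * x + a * (x + 1)) := by ring_nf
    _ ≤ Real.Gamma x ^ (1 - a) * Real.Gamma (x + 1) ^ a :=
      Real.Gamma_mul_add_mul_le_rpow_Gamma_mul_rpow_Gamma hx (by positivity) (by linarith) ha0
        (by ring)
    _ = x ^ a * (Real.Gamma x ^ (1 - a) * Real.Gamma x ^ a) := by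
      rw [Real.Gamma_add_one hx.ne', Real.mul_rpow hx.le hΓ.le]
      ring
    _ = x ^ a * Real.Gamma x := by
      rw [← Real.rpow_add hΓ, sub_add_cancel, Real.rpow_one]

/-- Gautschi-type inequality from log-convexity of `Γ`: for `α ∈ (0,1)` and
`x ≥ 1`, `(x + α − 1)^α ≤ Γ(x+α)/Γ(x) ≤ x^α`. -/
theorem gamma_ratio_bounds (α x : ℝ) (hα0 : 0 < α) (hα1 : α < 1) (hx : 1 ≤ x) :
    (x + α - 1) ^ α ≤ Real.Gamma (x + α) / Real.Gamma x ∧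
    Real.Gamma (x + α) / Real.Gamma x ≤ x ^ α := by
  have hx0 : 0 < x := by linarith
  have hΓ := Real.Gamma_pos_of_pos hx0
  refine ⟨?_, (div_le_iff₀ hΓ).2 (Real.Gamma_add_le_rpow_mul_Gamma hx0 hα0 hα1)⟩
  rw [le_div_iff₀ hΓ]
  obtain ⟨y, rfl⟩ : ∃ y, x = y + (1 - α) := ⟨x - (1 - α), by ring⟩
  have hy : 0 < y := by linarith
  rw [show y + (1 - α) + α - 1 = y by ring, show y + (1 - α) + α = y + 1 by ring]
  calc y ^ α * Real.Gamma (y + (1 - α)) ≤ y ^ α * (y ^ (1 - α) * Real.Gamma y) := by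
        gcongr
        exact Real.Gamma_add_le_rpow_mul_Gamma hy (by linarith) (by linarith)
    _ = Real.Gamma (y + 1) := by
      rw [← mul_assoc, ← Real.rpow_add hy, add_sub_cancel, Real.rpow_one,
        Real.Gamma_add_one hy.ne']
end

section
/- Let Y be a random vector in ℝ^d with finite second moments and let Y_1,...,Y_d be independent random vectors each distributed as Y. Then det(E(Y Y^T)) = (1/d!)·E((det[Y_1, ..., Y_d])²), where [Y_1,...,Y_d] is the d×d matrix with columns Y_1,...,Y_d. -/
open MeasureTheory

/-- **Andréief's identity**: the integral of a product of two determinants `det (f i (x j))` and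
`det (g i (x j))` over a product measure is `n!` times the determinant of the matrix of integrals
of the products `f i * g j`. -/
theorem integral_det_mul_det_eq_factorial_mul_det {ι α 𝕜 : Type*} [Fintype ι] [DecidableEq ι]
    [RCLike 𝕜] [MeasurableSpace α] (μ : Measure α) [SigmaFinite μ] (f g : ι → α → 𝕜)
    (hfg : ∀ i j, Integrable (fun x => f i x * g j x) μ) :
    ∫ x : ι → α, (Matrix.of fun i j => f i (x j)).det * (Matrix.of fun i j => g i (x j)).det
        ∂(Measure.pi fun _ => μ) =
      (Fintype.card ι).factorial * (Matrix.of fun i j => ∫ x, f i x * g j x ∂μ).det := by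
  set A : Matrix ι ι 𝕜 := Matrix.of fun i j => ∫ x, f i x * g j x ∂μ
  have hint (σ τ : Equiv.Perm ι) : Integrable (fun x : ι → α =>
      ((Equiv.Perm.sign τ : ℤ) : 𝕜) * (((Equiv.Perm.sign σ : ℤ) : 𝕜) *
        ∏ k, (f (σ k) (x k) * g (τ k) (x k)))) (Measure.pi fun _ => μ) :=
    ((Integrable.fintype_prod (f := fun k y => f (σ k) y * g (τ k) y)
      fun k => hfg (σ k) (τ k)).const_mul _).const_mul _
  have hexpand (x : ι → α) :
      (Matrix.of fun i j => f i (x j)).det * (Matrix.of fun i j => g i (x j)).det =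
        ∑ τ : Equiv.Perm ι, ∑ σ : Equiv.Perm ι, ((Equiv.Perm.sign τ : ℤ) : 𝕜) *
          (((Equiv.Perm.sign σ : ℤ) : 𝕜) * ∏ k, (f (σ k) (x k) * g (τ k) (x k))) := by
    simp only [Matrix.det_apply', Matrix.of_apply, Finset.sum_mul_sum, Finset.prod_mul_distrib]
    rw [Finset.sum_comm]
    refine Finset.sum_congr rfl fun τ _ => Finset.sum_congr rfl fun σ _ => ?_
    ring
  have hperm (τ : Equiv.Perm ι) :
      ∑ σ : Equiv.Perm ι, ((Equiv.Perm.sign σ : ℤ) : 𝕜) * ∏ k, A (σ k) (τ k) =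
        ((Equiv.Perm.sign τ : ℤ) : 𝕜) * A.det := by
    rw [← Matrix.det_permute' τ A, Matrix.det_apply']
    rfl
  have hsign (τ : Equiv.Perm ι) :
      ((Equiv.Perm.sign τ : ℤ) : 𝕜) * ((Equiv.Perm.sign τ : ℤ) : 𝕜) = 1 := by
    rw [← Int.cast_mul, Int.units_coe_mul_self, Int.cast_one]
  simp_rw [hexpand]
  rw [integral_finsetSum _ fun τ _ => integrable_finsetSum _ fun σ _ => hint σ τ]
  calc
    _ = ∑ τ : Equiv.Perm ι, ((Equiv.Perm.sign τ : ℤ) : 𝕜) *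
          ∑ σ : Equiv.Perm ι, ((Equiv.Perm.sign σ : ℤ) : 𝕜) * ∏ k, A (σ k) (τ k) := by
      refine Finset.sum_congr rfl fun τ _ => ?_
      rw [integral_finsetSum _ fun σ _ => hint σ τ, Finset.mul_sum]
      refine Finset.sum_congr rfl fun σ _ => ?_
      rw [integral_const_mul, integral_const_mul,
        integral_fintype_prod_eq_prod (f := fun k y => f (σ k) y * g (τ k) y)]
      rfl
    _ = ∑ _τ : Equiv.Perm ι, A.det := by
      simp only [hperm, ← mul_assoc, hsign, one_mul]
    _ = _ := by simp [Fintype.card_perm]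

/-- Products of two coordinates are integrable for a measure with finite second moment. -/
theorem integrable_coord_mul_coord {ι : Type*} [Fintype ι] {ν : Measure (EuclideanSpace ℝ ι)}
    (h2 : Integrable (fun x => ‖x‖ ^ 2) ν) (i j : ι) :
    Integrable (fun x => x i * x j) ν := by
  refine h2.mono' (by fun_prop) (.of_forall fun x => ?_)
  rw [norm_mul, sq]
  gcongr <;> exact PiLp.norm_apply_le x _

/-- If `Y` is a random vector in `ℝ^d` with finite second moments (with
distribution `ν`) and `Y₁, …, Y_d` are iid copies of `Y` (jointly distributed
according to the product measure `ν ⊗ ⋯ ⊗ ν`), then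
`det E(Y Yᵀ) = (1/d!) · E((det [Y₁, …, Y_d])²)`. -/
theorem det_second_moment_matrix_eq_expected_sq_det
    (d : ℕ) (ν : Measure (EuclideanSpace ℝ (Fin d))) [IsProbabilityMeasure ν]
    (h2 : Integrable (fun x => ‖x‖ ^ 2) ν) :
    (Matrix.of fun i j => ∫ x, x i * x j ∂ν).det =
      (1 / (d.factorial : ℝ)) *
        ∫ Y : Fin d → EuclideanSpace ℝ (Fin d),
          (Matrix.of fun i j => Y j i).det ^ 2 ∂(Measure.pi fun _ => ν) := by
  have h := integral_det_mul_det_eq_factorial_mul_det ν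
    (fun i (x : EuclideanSpace ℝ (Fin d)) => x i) (fun i x => x i)
    (integrable_coord_mul_coord h2)
  simp only [← sq, Fintype.card_fin] at h
  rw [h, one_div, inv_mul_cancel_left₀ (by positivity)]
end
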